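/- arXiv:1103.6065 — 2 statements merged into one kernel-verified Lean document; each statement's English description precedes it below -/
import Mathlib

section
/- There exists a real Banach space U that is of universal disposition for finite-dimensional spaces but not of universal disposition for separable spaces. -/
/-- Universal disposition for finite-dimensional spaces. -/
def UnivDispFinDim (U : Type*) [NormedAddCommGroup U] [NormedSpace ℝ U] : Prop :=
  ∀ (A B : Type) [NormedAddCommGroup A] [NormedSpace ℝ A] [FiniteDimensional ℝ A]
    [NormedAddCommGroup B] [NormedSpace ℝ B] [FiniteDimensional ℝ B]
    (u : A →ₗᵢ[ℝ] U) (j : A →ₗᵢ[ℝ] B),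
    ∃ u' : B →ₗᵢ[ℝ] U, ∀ a : A, u' (j a) = u a

/-- Universal disposition for separable spaces. -/
def UnivDispSeparable (U : Type*) [NormedAddCommGroup U] [NormedSpace ℝ U] : Prop :=
  ∀ (A B : Type) [NormedAddCommGroup A] [NormedSpace ℝ A] [CompleteSpace A]
    [TopologicalSpace.SeparableSpace A]
    [NormedAddCommGroup B] [NormedSpace ℝ B] [CompleteSpace B]
    [TopologicalSpace.SeparableSpace B]
    (u : A →ₗᵢ[ℝ] U) (j : A →ₗᵢ[ℝ] B),
    ∃ u' : B →ₗᵢ[ℝ] U, ∀ a : A, u' (j a) = u a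

/-- A bundled real Banach space. -/
structure BanachSpaceR : Type 1 where
  carrier : Type
  [norm : NormedAddCommGroup carrier]
  [space : NormedSpace ℝ carrier]
  [complete : CompleteSpace carrier]

attribute [instance] BanachSpaceR.norm BanachSpaceR.space BanachSpaceR.complete

open Filter Topology

namespace FinDimDisposition

/-- Names for the generators of the space: a sequence of basic generators, and, for every sequence
`s` of generators and every set `c` of requirements `(x, r)`, a generator meant to lie at distance
at most `r` from the combination `x` of the sequence `s`. -/
inductive Gen : Type
  | base (n : ℕ)
  | adjoin (s : ℕ → Gen) (c : Set ((ℕ →₀ ℝ) × ℝ))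

namespace Gen

/-- The null sequence `t` is a possible value for a new generator subject to the requirements `c`,
when `v` lists the values of the old generators. -/
def IsSol (v : ℕ → ℕ → ℝ) (c : Set ((ℕ →₀ ℝ) × ℝ)) (t : ℕ → ℝ) : Prop :=
  Tendsto t atTop (𝓝 0) ∧
    ∀ m, ∀ p ∈ c, |Finsupp.linearCombination ℝ (fun n => v n m) p.1 - t m| ≤ p.2

/-- The basic generators are sent to null sequences, contractively for the supremum norm. -/
def BaseAdm (Φ : Gen → ℕ → ℝ) : Prop :=
  (∀ n, Tendsto (Φ (.base n)) atTop (𝓝 0)) ∧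
    ∀ m (F : Finset ℕ), ∑ n ∈ F, |Φ (.base n) m| ≤ 1

/-- `Adm j Φ` says that `Φ` is an admissible assignment of null sequences to the generators
from which `j` is built. -/
def Adm : Gen → (Gen → ℕ → ℝ) → Prop
  | .base _, Φ => BaseAdm Φ
  | .adjoin s c, Φ => (∀ n, Adm (s n) Φ) ∧
      ((c.Nonempty ∧ ∀ Ψ, (∀ n, Adm (s n) Ψ) → ∃ t, IsSol (fun n => Ψ (s n)) c t) →
        IsSol (fun n => Φ (s n)) c (Φ (.adjoin s c))) ∧
      (¬ (c.Nonempty ∧ ∀ Ψ, (∀ n, Adm (s n) Ψ) → ∃ t, IsSol (fun n => Ψ (s n)) c t) →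
        Φ (.adjoin s c) = 0)

/-- Every admissible assignment on `s` can be extended to a generator subject to `c`. -/
def Solvable (s : ℕ → Gen) (c : Set ((ℕ →₀ ℝ) × ℝ)) : Prop :=
  c.Nonempty ∧ ∀ Ψ, (∀ n, Adm (s n) Ψ) → ∃ t, IsSol (fun n => Ψ (s n)) c t

theorem adm_adjoin_iff {s : ℕ → Gen} {c : Set ((ℕ →₀ ℝ) × ℝ)} {Φ : Gen → ℕ → ℝ} :
    Adm (.adjoin s c) Φ ↔ (∀ n, Adm (s n) Φ) ∧
      (Solvable s c → IsSol (fun n => Φ (s n)) c (Φ (.adjoin s c))) ∧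
      (¬ Solvable s c → Φ (.adjoin s c) = 0) := Iff.rfl

theorem Adm.baseAdm : ∀ {j : Gen} {Φ : Gen → ℕ → ℝ}, Adm j Φ → BaseAdm Φ
  | .base _, _, h => h
  | .adjoin _ _, _, h => ((adm_adjoin_iff.1 h).1 0).baseAdm

open scoped Classical in
/-- The admissible assignment which follows `σ` as long as this is possible. -/
noncomputable def extend (σ : Gen → ℕ → ℝ) : Gen → ℕ → ℝ
  | .base n => σ (.base n)
  | .adjoin s c =>
      if Solvable s c then
        if IsSol (fun n => extend σ (s n)) c (σ (.adjoin s c)) then σ (.adjoin s c)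
        else if h : ∃ t, IsSol (fun n => extend σ (s n)) c t then h.choose else 0
      else 0

theorem adm_extend {σ : Gen → ℕ → ℝ} (hσ : BaseAdm σ) : ∀ j, Adm j (extend σ)
  | .base n => by
    have h : ∀ n, extend σ (.base n) = σ (.base n) := fun n => by rw [extend]
    simpa [Adm, BaseAdm, h] using hσ
  | .adjoin s c => by
    have ih : ∀ n, Adm (s n) (extend σ) := fun n => adm_extend hσ (s n)
    refine adm_adjoin_iff.2 ⟨ih, fun hS => ?_, fun hS => ?_⟩
    · rw [extend, if_pos hS]
      split_ifs with h1 h2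
      · exact h1
      · exact h2.choose_spec
      · exact absurd (hS.2 _ ih) h2
    · rw [extend, if_neg hS]

theorem extend_eq_of_adm {σ : Gen → ℕ → ℝ} : ∀ {j : Gen}, Adm j σ → extend σ j = σ j
  | .base n, _ => by rw [extend]
  | .adjoin s c, h => by
    obtain ⟨h1, h2, h3⟩ := adm_adjoin_iff.1 h
    have ih : ∀ n, extend σ (s n) = σ (s n) := fun n => extend_eq_of_adm (h1 n)
    rw [extend]
    split_ifs with hS h4 h5
    · rfl
    · simp only [ih] at h4
      exact absurd (h2 hS) h4
    · simp only [ih] at h4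
      exact absurd (h2 hS) h4
    · exact (h3 hS).symm

/-- `Occurs i j` says that `i` is one of the generators from which `j` is built, or `j` itself. -/
def Occurs (i : Gen) : Gen → Prop
  | .base n => i = .base n
  | .adjoin s c => i = .adjoin s c ∨ ∃ n, Occurs i (s n)

theorem occurs_refl : ∀ i, Occurs i i
  | .base _ => rfl
  | .adjoin _ _ => Or.inl rfl

theorem Occurs.trans {i j : Gen} (hij : Occurs i j) : ∀ {k : Gen}, Occurs j k → Occurs i k
  | .base _, h => by
    obtain rfl : j = _ := h
    exact hij
  | .adjoin s c, h => by
    rcases h with rfl | ⟨n, hn⟩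
    · exact hij
    · exact Or.inr ⟨n, hij.trans hn⟩

theorem not_occurs_child : ∀ (s : ℕ → Gen) (c : Set ((ℕ →₀ ℝ) × ℝ)) (n : ℕ),
    ¬ Occurs (.adjoin s c) (s n) := by
  suffices h : ∀ j : Gen, ∀ s c n, j = s n → ¬ Occurs (.adjoin s c) j from
    fun s c n => h _ s c n rfl
  intro j
  induction j with
  | base m => intro s c n _ h; exact absurd h (by simp [Occurs])
  | adjoin s' c' ih =>
    rintro s c n hj (h | ⟨k, hk⟩)
    · obtain ⟨rfl, rfl⟩ := Gen.adjoin.inj h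
      exact ih n s c n rfl (hj ▸ occurs_refl _)
    · exact ih k s' c' k rfl (Occurs.trans (hj ▸ Or.inr ⟨n, occurs_refl _⟩) hk)

theorem extend_update_of_not_occurs {Φ : Gen → ℕ → ℝ} (hΦ : ∀ j, Adm j Φ) [DecidableEq Gen]
    (i : Gen) (t : ℕ → ℝ) : ∀ {j : Gen}, ¬ Occurs i j → extend (Function.update Φ i t) j = Φ j
  | .base n, h => by
    rw [extend, Function.update_of_ne]
    exact fun h' => h h'.symm
  | .adjoin s c, h => by
    have hne : Gen.adjoin s c ≠ i := fun h' => h (Or.inl h'.symm)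
    have ih : ∀ n, extend (Function.update Φ i t) (s n) = Φ (s n) := fun n =>
      extend_update_of_not_occurs hΦ i t fun h' => h (Or.inr ⟨n, h'⟩)
    obtain ⟨-, h2, h3⟩ := adm_adjoin_iff.1 (hΦ (.adjoin s c))
    rw [extend]
    split_ifs with hS h4 h5
    · rw [Function.update_of_ne hne]
    · simp only [ih, Function.update_of_ne hne] at h4
      exact absurd (h2 hS) h4
    · simp only [ih, Function.update_of_ne hne] at h4
      exact absurd (h2 hS) h4
    · exact (h3 hS).symm

/-- An admissible assignment can be redefined at `Gen.adjoin s c` by any solution, without changing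
its values on `s`. -/
theorem exists_adm_of_isSol {Φ : Gen → ℕ → ℝ} (hΦ : ∀ j, Adm j Φ) {s : ℕ → Gen}
    {c : Set ((ℕ →₀ ℝ) × ℝ)} (hS : Solvable s c) {t : ℕ → ℝ}
    (ht : IsSol (fun n => Φ (s n)) c t) :
    ∃ Ψ : Gen → ℕ → ℝ, (∀ j, Adm j Ψ) ∧ (∀ n, Ψ (s n) = Φ (s n)) ∧ Ψ (.adjoin s c) = t := by
  classical
  have h (n : ℕ) : extend (Function.update Φ (.adjoin s c) t) (s n) = Φ (s n) :=
    extend_update_of_not_occurs hΦ _ t (not_occurs_child s c n)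
  refine ⟨extend (Function.update Φ (.adjoin s c) t), adm_extend ?_, h, ?_⟩
  · simpa [BaseAdm] using (hΦ (.base 0)).baseAdm
  · rw [extend, if_pos hS, if_pos]
    · simp
    · simpa only [h, Function.update_self] using ht

end Gen

open Gen

/-- The real-valued assignments satisfying the requirements of all generators. -/
def Functionals : Set (Gen → ℝ) :=
  {φ | (∀ F : Finset ℕ, ∑ n ∈ F, |φ (.base n)| ≤ 1) ∧ ∀ s c,
    (Solvable s c → ∀ p ∈ c,
      |Finsupp.linearCombination ℝ (fun n => φ (s n)) p.1 - φ (.adjoin s c)| ≤ p.2) ∧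
    (¬ Solvable s c → φ (.adjoin s c) = 0)}

theorem adm_iff {Φ : Gen → ℕ → ℝ} : (∀ j, Adm j Φ) ↔
    (∀ m, (fun j => Φ j m) ∈ Functionals) ∧ ∀ j, Tendsto (Φ j) atTop (𝓝 0) := by
  constructor
  · refine fun h => ⟨fun m => ⟨(h (.base 0)).baseAdm.2 m, fun s c => ⟨fun hS => ?_, fun hS => ?_⟩⟩,
      fun j => ?_⟩
    · exact ((adm_adjoin_iff.1 (h (.adjoin s c))).2.1 hS).2 m
    · simp [(adm_adjoin_iff.1 (h (.adjoin s c))).2.2 hS]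
    · cases j with
      | base n => exact (h (.base n)).baseAdm.1 n
      | adjoin s c =>
        obtain ⟨-, h2, h3⟩ := adm_adjoin_iff.1 (h (.adjoin s c))
        by_cases hS : Solvable s c
        · exact (h2 hS).1
        · rw [h3 hS]
          exact tendsto_const_nhds
  · rintro ⟨h1, h2⟩ j
    induction j with
    | base n => exact ⟨fun n => h2 _, fun m => (h1 m).1⟩
    | adjoin s c ih =>
      exact adm_adjoin_iff.2 ⟨ih, fun hS => ⟨h2 _, fun m => ((h1 m).2 s c).1 hS⟩,
        fun hS => funext fun m => ((h1 m).2 s c).2 hS⟩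

theorem abs_linearCombination_le {v M : ℕ → ℝ} (h : ∀ n, |v n| ≤ M n) (x : ℕ →₀ ℝ) :
    |Finsupp.linearCombination ℝ v x| ≤ x.sum fun n a => |a| * M n := by
  rw [Finsupp.linearCombination_apply, Finsupp.sum, Finsupp.sum]
  refine (Finset.abs_sum_le_sum_abs _ _).trans (Finset.sum_le_sum fun n _ => ?_)
  rw [smul_eq_mul, abs_mul]
  exact mul_le_mul_of_nonneg_left (h n) (abs_nonneg _)

theorem exists_bound (j : Gen) : ∃ M, ∀ φ ∈ Functionals, |φ j| ≤ M := by
  induction j with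
  | base n => exact ⟨1, fun φ hφ => by simpa using hφ.1 {n}⟩
  | adjoin s c ih =>
    by_cases hS : Solvable s c
    · choose M hM using ih
      obtain ⟨p, hp⟩ := hS.1
      refine ⟨(p.1.sum fun n a => |a| * M n) + p.2, fun φ hφ => ?_⟩
      have h1 := (hφ.2 s c).1 hS p hp
      have h2 := abs_linearCombination_le (fun n => hM n φ hφ) p.1
      rw [abs_le] at *
      constructor <;> linarith
    · exact ⟨0, fun φ hφ => by simp [(hφ.2 s c).2 hS]⟩

/-- The ambient space of bounded functions on `Functionals`. -/
abbrev Ambient : Type := lp (fun _ : Functionals => ℝ) ⊤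

/-- The evaluation at a generator, as a bounded function on `Functionals`. -/
noncomputable def gen (j : Gen) : Ambient :=
  ⟨fun φ => φ.1 j, memℓp_infty (by
    obtain ⟨M, hM⟩ := exists_bound j
    refine ⟨M, ?_⟩
    rintro _ ⟨φ, rfl⟩
    exact hM φ.1 φ.2)⟩

/-- The evaluation of a bounded function at a point. -/
noncomputable def evalAt (φ : Functionals) : Ambient →L[ℝ] ℝ :=
  lp.evalCLM ℝ (fun _ : Functionals => ℝ) ⊤ φ

theorem evalAt_gen (φ : Functionals) (j : Gen) : evalAt φ (gen j) = φ.1 j := rfl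

theorem abs_evalAt_le (φ : Functionals) (f : Ambient) : |evalAt φ f| ≤ ‖f‖ :=
  lp.norm_apply_le_norm (by simp) f φ

theorem norm_le_of_abs_evalAt_le {f : Ambient} {C : ℝ} (hC : 0 ≤ C)
    (h : ∀ φ, |evalAt φ f| ≤ C) : ‖f‖ ≤ C :=
  lp.norm_le_of_forall_le hC h

/-- The combinations of a sequence of generators. -/
noncomputable def comb (s : ℕ → Gen) : (ℕ →₀ ℝ) →ₗ[ℝ] Ambient :=
  Finsupp.linearCombination ℝ fun n => gen (s n)

theorem map_comb (G : Ambient →L[ℝ] ℝ) (s : ℕ → Gen) (x : ℕ →₀ ℝ) :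
    G (comb s x) = Finsupp.linearCombination ℝ (fun n => G (gen (s n))) x :=
  Finsupp.apply_linearCombination ℝ (G : Ambient →ₗ[ℝ] ℝ) _ x

theorem evalAt_comb (φ : Functionals) (s : ℕ → Gen) (x : ℕ →₀ ℝ) :
    evalAt φ (comb s x) = Finsupp.linearCombination ℝ (fun n => φ.1 (s n)) x :=
  map_comb _ s x

theorem sum_abs_apply_gen_base_le (G : Ambient →L[ℝ] ℝ) (hG : ‖G‖ ≤ 1) (F : Finset ℕ) :
    ∑ n ∈ F, |G (gen (.base n))| ≤ 1 := by
  have h : ∑ n ∈ F, |G (gen (.base n))| =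
      G (∑ n ∈ F, (SignType.sign (G (gen (.base n))) : ℝ) • gen (.base n)) := by
    simp [map_sum, sign_mul_self]
  rw [h]
  refine (le_abs_self _).trans ((G.le_of_opNorm_le hG _).trans ?_)
  rw [one_mul]
  refine norm_le_of_abs_evalAt_le zero_le_one fun φ => ?_
  rw [map_sum]
  refine (Finset.abs_sum_le_sum_abs _ _).trans
    (le_trans (Finset.sum_le_sum fun n _ => ?_) (φ.2.1 F))
  rw [map_smul, evalAt_gen, smul_eq_mul, abs_mul]
  refine mul_le_of_le_one_left (abs_nonneg _) ?_
  cases SignType.sign (G (gen (.base n))) <;> simp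

theorem comp_gen_mem (G : Ambient →L[ℝ] ℝ) (hG : ‖G‖ ≤ 1) :
    (fun j => G (gen j)) ∈ Functionals := by
  refine ⟨sum_abs_apply_gen_base_le G hG, fun s c => ⟨fun hS p hp => ?_, fun hS => ?_⟩⟩
  · rw [← map_comb, ← map_sub]
    refine (G.le_of_opNorm_le hG _).trans ?_
    rw [one_mul]
    refine norm_le_of_abs_evalAt_le ?_ fun φ => ?_
    · obtain ⟨t, ht⟩ := hS.2 (extend fun _ _ => 0) fun n =>
        adm_extend ⟨fun _ => tendsto_const_nhds, by simp⟩ (s n)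
      exact (abs_nonneg _).trans (ht.2 0 p hp)
    · rw [map_sub, evalAt_comb, evalAt_gen]
      exact (φ.2.2 s c).1 hS p hp
  · have : gen (.adjoin s c) = 0 := by
      refine norm_le_zero_iff.1 (norm_le_of_abs_evalAt_le le_rfl fun φ => ?_)
      rw [evalAt_gen, (φ.2.2 s c).2 hS, abs_zero]
    simp only [this, map_zero]

theorem zero_mem_functionals : (fun _ => 0) ∈ Functionals := by
  simpa using comp_gen_mem 0 (by simp)

/-- The closed linear span of all generators. -/
noncomputable def Disp : Submodule ℝ Ambient :=
  (Submodule.span ℝ (Set.range gen)).topologicalClosure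

theorem gen_mem_disp (j : Gen) : gen j ∈ Disp :=
  Submodule.le_topologicalClosure _ (Submodule.subset_span ⟨j, rfl⟩)

theorem tendsto_evalAt {φ : ℕ → Functionals}
    (hφ : ∀ j, Tendsto (fun m => (φ m).1 j) atTop (𝓝 0)) {f : Ambient} (hf : f ∈ Disp) :
    Tendsto (fun m => evalAt (φ m) f) atTop (𝓝 0) := by
  have hspan : ∀ g ∈ Submodule.span ℝ (Set.range gen),
      Tendsto (fun m => evalAt (φ m) g) atTop (𝓝 0) := by
    intro g hg
    induction hg using Submodule.span_induction with
    | mem x hx => obtain ⟨j, rfl⟩ := hx; exact hφ j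
    | zero => simp
    | add x y _ _ hx hy => simpa using hx.add hy
    | smul a x _ hx => simpa using hx.const_mul a
  rw [Metric.tendsto_atTop]
  intro ε hε
  obtain ⟨g, hg, hgf⟩ := Metric.mem_closure_iff.1 hf (ε / 2) (half_pos hε)
  obtain ⟨N, hN⟩ := Metric.tendsto_atTop.1 (hspan g hg) (ε / 2) (half_pos hε)
  refine ⟨N, fun n hn => ?_⟩
  have h1 := hN n hn
  have h2 := abs_evalAt_le (φ n) (f - g)
  rw [dist_eq_norm] at hgf
  rw [Real.dist_eq, sub_zero] at *
  rw [map_sub] at h2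
  have := abs_sub_abs_le_abs_sub (evalAt (φ n) f) (evalAt (φ n) g)
  linarith

theorem exists_countable_mem {f : Ambient} (hf : f ∈ Disp) : ∃ C : Set Gen, C.Countable ∧
    f ∈ (Submodule.span ℝ (gen '' C)).topologicalClosure := by
  obtain ⟨x, hx, hxf⟩ := mem_closure_iff_seq_limit.1 hf
  have h (m : ℕ) : ∃ T : Finset Gen, x m ∈ Submodule.span ℝ (gen '' (T : Set Gen)) := by
    obtain ⟨l, hl⟩ := Finsupp.mem_span_range_iff_exists_finsupp.1 (hx m)
    refine ⟨l.support, hl ▸ Submodule.sum_mem _ fun j hj => ?_⟩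
    exact Submodule.smul_mem _ _ (Submodule.subset_span ⟨j, hj, rfl⟩)
  choose T hT using h
  refine ⟨⋃ m, (T m : Set Gen), Set.countable_iUnion fun m => (T m).countable_toSet, ?_⟩
  refine mem_closure_of_tendsto hxf (Eventually.of_forall fun m => ?_)
  exact Submodule.span_mono (Set.image_mono (Set.subset_iUnion_of_subset m subset_rfl)) (hT m)

theorem exists_sequence_of_finite {ι : Type*} [Finite ι] {f : ι → Ambient} (hf : ∀ i, f i ∈ Disp) :
    ∃ s : ℕ → Gen, ∀ i, f i ∈ (LinearMap.range (comb s)).topologicalClosure := by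
  choose C hC hfC using fun i => exists_countable_mem (hf i)
  obtain ⟨s, hs⟩ := ((Set.countable_iUnion hC).insert (Gen.base 0)).exists_eq_range
    (Set.insert_nonempty _ _)
  refine ⟨s, fun i => Submodule.topologicalClosure_mono ?_ (hfC i)⟩
  rw [comb, Finsupp.range_linearCombination]
  refine Submodule.span_mono ?_
  rw [Set.range_comp' gen s, ← hs]
  exact Set.image_mono ((Set.subset_iUnion C i).trans (Set.subset_insert _ _))

theorem exists_sequence {A : Type*} [NormedAddCommGroup A] [NormedSpace ℝ A]
    [FiniteDimensional ℝ A] (u : A →ₗ[ℝ] Ambient) (hu : ∀ a, u a ∈ Disp) :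
    ∃ s : ℕ → Gen, ∀ a, u a ∈ (LinearMap.range (comb s)).topologicalClosure := by
  let b := Module.finBasis ℝ A
  obtain ⟨s, hs⟩ := exists_sequence_of_finite fun i => hu (b i)
  refine ⟨s, fun a => ?_⟩
  rw [← b.sum_repr a, map_sum]
  exact Submodule.sum_mem _ fun i _ => by
    rw [map_smul]
    exact Submodule.smul_mem _ _ (hs i)

theorem tendsto_norm_of_tendsto_apply {A : Type*} [NormedAddCommGroup A] [NormedSpace ℝ A]
    [FiniteDimensional ℝ A] {f : ℕ → A →L[ℝ] ℝ}
    (hf : ∀ a, Tendsto (fun m => f m a) atTop (𝓝 0)) :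
    Tendsto (fun m => ‖f m‖) atTop (𝓝 0) := by
  let b := Module.finBasis ℝ A
  obtain ⟨C, -, hC⟩ := b.exists_opNorm_le (F := ℝ)
  have h : Tendsto (fun m => C * ∑ i, ‖f m (b i)‖) atTop (𝓝 0) := by
    simpa using (tendsto_finsetSum _ fun i _ => (hf (b i)).norm).const_mul C
  refine squeeze_zero (fun _ => norm_nonneg _) (fun m => ?_) h
  exact hC (Finset.sum_nonneg fun _ _ => norm_nonneg _) fun i =>
    Finset.single_le_sum (f := fun i => ‖f m (b i)‖) (fun _ _ => norm_nonneg _) (Finset.mem_univ i)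

/-- A functional on a subspace extends along a second isometric embedding of that subspace. -/
theorem exists_extension {A E : Type*} [NormedAddCommGroup A] [NormedSpace ℝ A]
    [NormedAddCommGroup E] [NormedSpace ℝ E] (u : A →ₗᵢ[ℝ] E) (g : A →L[ℝ] ℝ) :
    ∃ G : E →L[ℝ] ℝ, ‖G‖ ≤ ‖g‖ ∧ ∀ a, G (u a) = g a := by
  let r := u.equivRange
  obtain ⟨G, hG, hGn⟩ := exists_extension_norm_eq (LinearMap.range u.toLinearMap)
    (g.comp (r.symm.toContinuousLinearEquiv : _ →L[ℝ] A))
  refine ⟨G, ?_, fun a => ?_⟩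
  · rw [hGn]
    refine ContinuousLinearMap.opNorm_le_bound _ (norm_nonneg _) fun x => ?_
    exact (g.le_opNorm _).trans_eq (by simp)
  · have := hG (r a)
    simpa [r] using this

section OnePoint

variable {B : Type*} [NormedAddCommGroup B] [NormedSpace ℝ B] {S : Submodule ℝ B}

/-- The requirements for a combination of the sequence `s` together with a new generator to realize
the distances of `e` to the points of `S`. -/
def distanceRequirements (u : S →ₗᵢ[ℝ] Ambient) (e : B) (s : ℕ → Gen) : Set ((ℕ →₀ ℝ) × ℝ) :=
  {p | ∃ a : S, ‖comb s p.1 - u a‖ + ‖(a : B) - e‖ ≤ p.2}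

theorem abs_comb_sub_le {u : S →ₗᵢ[ℝ] Ambient} {e : B} {s : ℕ → Gen} {p : (ℕ →₀ ℝ) × ℝ}
    (hp : p ∈ distanceRequirements u e s) {G : Ambient →L[ℝ] ℝ} {g : B →L[ℝ] ℝ} (hG : ‖G‖ ≤ 1)
    (hg : ‖g‖ ≤ 1) (h : ∀ a : S, G (u a) = g a) : |G (comb s p.1) - g e| ≤ p.2 := by
  obtain ⟨a, ha⟩ := hp
  have h1 := G.le_of_opNorm_le hG (comb s p.1 - u a)
  have h2 := g.le_of_opNorm_le hg (a - e)
  have h3 : G (comb s p.1) - g e = G (comb s p.1 - u a) + g (a - e) := by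
    rw [map_sub, map_sub, h a]; ring
  rw [h3]
  refine (abs_add_le _ _).trans ?_
  rw [one_mul, Real.norm_eq_abs] at h1 h2
  linarith

theorem norm_evalAt_le (φ : Functionals) : ‖evalAt φ‖ ≤ 1 :=
  ContinuousLinearMap.opNorm_le_bound _ zero_le_one fun f => by
    simpa using abs_evalAt_le φ f

theorem solvable_distanceRequirements [FiniteDimensional ℝ S] {u : S →ₗᵢ[ℝ] Ambient}
    (hu : ∀ a, u a ∈ Disp) (e : B) (s : ℕ → Gen) :
    Solvable s (distanceRequirements u e s) := by
  refine ⟨⟨(0, ‖e‖), 0, by simp⟩, fun Ψ hΨ => ?_⟩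
  have hadm := adm_extend (hΨ 0).baseAdm
  obtain ⟨h1, h2⟩ := adm_iff.1 hadm
  have hext (n : ℕ) : extend Ψ (s n) = Ψ (s n) := extend_eq_of_adm (hΨ n)
  let φ : ℕ → Functionals := fun m => ⟨_, h1 m⟩
  let f : ℕ → S →L[ℝ] ℝ := fun m => (evalAt (φ m)).comp u.toContinuousLinearMap
  have hf (m : ℕ) : ‖f m‖ ≤ 1 := by
    refine ContinuousLinearMap.opNorm_le_bound _ zero_le_one fun a => ?_
    simpa [f] using abs_evalAt_le (φ m) (u a)
  have hf0 : Tendsto (fun m => ‖f m‖) atTop (𝓝 0) :=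
    tendsto_norm_of_tendsto_apply fun a => tendsto_evalAt (φ := φ) h2 (hu a)
  choose g hgn hg using fun m => exists_extension S.subtypeₗᵢ (f m)
  refine ⟨fun m => g m e, ?_, fun m p hp => ?_⟩
  · refine squeeze_zero_norm (fun m => ?_) (by simpa using hf0.mul_const ‖e‖)
    exact (g m).le_of_opNorm_le (hgn m) e
  · have := abs_comb_sub_le hp (norm_evalAt_le (φ m)) ((hgn m).trans (hf m))
      fun a => (hg m a).symm
    rw [evalAt_comb] at this
    simpa only [φ, hext] using this

theorem norm_sub_gen_le {u : S →ₗᵢ[ℝ] Ambient} {e : B} {s : ℕ → Gen}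
    (hS : Solvable s (distanceRequirements u e s)) {a : S}
    (ha : u a ∈ (LinearMap.range (comb s)).topologicalClosure) :
    ‖u a - gen (.adjoin s (distanceRequirements u e s))‖ ≤ ‖(a : B) - e‖ := by
  refine le_of_forall_pos_le_add fun ε hε => ?_
  obtain ⟨_, ⟨x, rfl⟩, hx⟩ := Metric.mem_closure_iff.1 ha (ε / 2) (half_pos hε)
  rw [dist_comm, dist_eq_norm] at hx
  have h1 : ‖comb s x - gen (.adjoin s (distanceRequirements u e s))‖ ≤
      ‖comb s x - u a‖ + ‖(a : B) - e‖ := by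
    refine norm_le_of_abs_evalAt_le (by positivity) fun φ => ?_
    rw [map_sub, evalAt_comb, evalAt_gen]
    exact (φ.2.2 _ _).1 hS (x, _) ⟨a, le_rfl⟩
  have h2 := norm_sub_le_norm_sub_add_norm_sub (u a) (comb s x)
    (gen (.adjoin s (distanceRequirements u e s)))
  rw [norm_sub_rev (u a) (comb s x)] at h2
  linarith

theorem le_norm_sub_gen {u : S →ₗᵢ[ℝ] Ambient} {e : B} {s : ℕ → Gen}
    (hS : Solvable s (distanceRequirements u e s)) {a : S}
    (ha : u a ∈ (LinearMap.range (comb s)).topologicalClosure) :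
    ‖(a : B) - e‖ ≤ ‖u a - gen (.adjoin s (distanceRequirements u e s))‖ := by
  obtain ⟨g, hg1, hg⟩ := exists_dual_vector'' ℝ ((a : B) - e)
  obtain ⟨G, hG1, hG⟩ := exists_extension u (g.comp S.subtypeL)
  have hG1 : ‖G‖ ≤ 1 := hG1.trans <| ContinuousLinearMap.opNorm_le_bound _ zero_le_one fun x =>
    g.le_of_opNorm_le hg1 x
  let Φ : Gen → ℕ → ℝ := fun j => Pi.single 0 (G (gen j))
  have hnull (x : ℝ) : Tendsto (Pi.single 0 x : ℕ → ℝ) atTop (𝓝 0) :=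
    tendsto_const_nhds.congr' <| (eventually_ne_atTop 0).mono fun m hm => by simp [hm]
  have hΦ : ∀ j, Adm j Φ := by
    refine adm_iff.2 ⟨fun m => ?_, fun j => hnull _⟩
    rcases eq_or_ne m 0 with rfl | hm
    · simpa [Φ] using comp_gen_mem G hG1
    · simpa [Φ, hm] using zero_mem_functionals
  have hsol : IsSol (fun n => Φ (s n)) (distanceRequirements u e s) (Pi.single 0 (g e)) := by
    refine ⟨hnull _, fun m p hp => ?_⟩
    rcases eq_or_ne m 0 with rfl | hm
    · simpa [Φ, map_comb] using abs_comb_sub_le hp hG1 hg1 hG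
    · have := abs_comb_sub_le (G := 0) (g := 0) hp (by simp) (by simp) (by simp)
      simpa [Φ, hm, Finsupp.linearCombination_apply] using this
  obtain ⟨Ψ, hΨ, hΨs, hΨe⟩ := exists_adm_of_isSol hΦ hS hsol
  let ψ : Functionals := ⟨_, (adm_iff.1 hΨ).1 0⟩
  have h1 : evalAt ψ (u a) = G (u a) := by
    have h : Set.EqOn (evalAt ψ) G (LinearMap.range (comb s) : Set Ambient) := by
      rintro _ ⟨x, rfl⟩
      rw [evalAt_comb, map_comb]
      simp [ψ, hΨs, Φ]
    exact h.closure (evalAt ψ).continuous G.continuous ha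
  have h2 : evalAt ψ (gen (.adjoin s (distanceRequirements u e s))) = g e := by
    rw [evalAt_gen]
    simp [ψ, hΨe]
  have h3 := abs_evalAt_le ψ (u a - gen (.adjoin s (distanceRequirements u e s)))
  rw [map_sub, h1, h2, hG] at h3
  refine le_trans ?_ h3
  have h4 : g.comp S.subtypeL a - g e = ‖(a : B) - e‖ := by
    rw [map_sub] at hg
    exact hg
  rw [h4]
  exact le_abs_self _

theorem exists_mem_norm_sub_eq [FiniteDimensional ℝ S] {u : S →ₗᵢ[ℝ] Ambient}
    (hu : ∀ a, u a ∈ Disp) (e : B) :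
    ∃ w ∈ Disp, ∀ a : S, ‖u a - w‖ = ‖(a : B) - e‖ := by
  obtain ⟨s, hs⟩ := exists_sequence u.toLinearMap hu
  have hS := solvable_distanceRequirements hu e s
  exact ⟨_, gen_mem_disp _, fun a =>
    (norm_sub_gen_le hS (hs a)).antisymm (le_norm_sub_gen hS (hs a))⟩

end OnePoint

section Extension

variable {B : Type*} [NormedAddCommGroup B] [NormedSpace ℝ B]

theorem exists_linearIsometry_sup {E : Type*} [NormedAddCommGroup E] [NormedSpace ℝ E]
    {S : Submodule ℝ B} (u : S →ₗᵢ[ℝ] E) {e : B} (he : e ∉ S) {w : E}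
    (hw : ∀ a : S, ‖u a - w‖ = ‖(a : B) - e‖) :
    ∃ v : ↥(S ⊔ Submodule.span ℝ {e}) →ₗᵢ[ℝ] E,
      (∀ a : S, v ⟨a, Submodule.mem_sup_left a.2⟩ = u a) ∧
        ∀ x, ∃ (a : S) (r : ℝ), v x = u a + r • w := by
  let p : B →ₗ.[ℝ] E := LinearPMap.supSpanSingleton ⟨S, u.toLinearMap⟩ e w he
  let q : ↥(S ⊔ Submodule.span ℝ {e}) →ₗ[ℝ] E := p.toFun
  have hp (a : S) (r : ℝ) (h : (a : B) + r • e ∈ S ⊔ Submodule.span ℝ {e}) :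
      q ⟨a + r • e, h⟩ = u a + r • w :=
    LinearPMap.supSpanSingleton_apply_mk ⟨S, u.toLinearMap⟩ e w he a a.2 r
  have hrep (x : ↥(S ⊔ Submodule.span ℝ {e})) : ∃ (a : S) (r : ℝ), (x : B) = a + r • e := by
    obtain ⟨a, ha, y, hy, hx⟩ := Submodule.mem_sup.1 x.2
    obtain ⟨r, rfl⟩ := Submodule.mem_span_singleton.1 hy
    exact ⟨⟨a, ha⟩, r, hx.symm⟩
  refine ⟨⟨q, fun x => ?_⟩, fun a => ?_, fun x => ?_⟩
  · obtain ⟨x, hx⟩ := x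
    obtain ⟨a, r, rfl : x = _⟩ := hrep ⟨x, hx⟩
    rw [hp a r hx]
    rcases eq_or_ne r 0 with rfl | hr
    · simp
    · have h := hw (-r⁻¹ • a)
      have h1 : u a + r • w = -r • (u (-r⁻¹ • a) - w) := by
        rw [map_smul, smul_sub, smul_smul]
        simp [hr]
      have h2 : (a : B) + r • e = -r • (((-r⁻¹ • a : S) : B) - e) := by
        rw [Submodule.coe_smul, smul_sub, smul_smul]
        simp [hr]
      change ‖u a + r • w‖ = ‖(a : B) + r • e‖
      rw [h1, h2, norm_smul, norm_smul, h]
  · have := hp a 0 (by simpa using Submodule.mem_sup_left a.2)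
    simpa using this
  · obtain ⟨x, hx⟩ := x
    obtain ⟨a, r, rfl : x = _⟩ := hrep ⟨x, hx⟩
    exact ⟨a, r, hp a r hx⟩

theorem exists_linearIsometry_extension [FiniteDimensional ℝ B] (S : Submodule ℝ B)
    (u : S →ₗᵢ[ℝ] Ambient) (hu : ∀ a, u a ∈ Disp) :
    ∃ v : B →ₗᵢ[ℝ] Ambient, (∀ b, v b ∈ Disp) ∧ ∀ a : S, v a = u a := by
  induction S using WellFoundedGT.induction with
  | ind S ih =>
    by_cases hS : S = ⊤
    · subst hS
      exact ⟨u.comp (LinearIsometryEquiv.ofTop B ⊤ rfl).symm.toLinearIsometry, fun b => hu _,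
        fun a => rfl⟩
    · obtain ⟨e, -, he⟩ := SetLike.exists_of_lt (lt_top_iff_ne_top.2 hS)
      obtain ⟨w, hwD, hw⟩ := exists_mem_norm_sub_eq hu e
      obtain ⟨v, hv, hvw⟩ := exists_linearIsometry_sup u he hw
      have hlt : S < S ⊔ Submodule.span ℝ {e} := by
        refine lt_of_le_of_ne le_sup_left fun h => he ?_
        rw [h]
        exact Submodule.mem_sup_right (Submodule.mem_span_singleton_self e)
      obtain ⟨v', hv', hvv'⟩ := ih _ hlt v fun x => by
        obtain ⟨a, r, h⟩ := hvw x
        rw [h]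
        exact Disp.add_mem (hu a) (Disp.smul_mem r hwD)
      exact ⟨v', hv', fun a => (hvv' ⟨a, _⟩).trans (hv a)⟩

end Extension

theorem univDispFinDim_disp : UnivDispFinDim Disp := by
  intro A B _ _ _ _ _ _ u j
  obtain ⟨v, hvD, hv⟩ := exists_linearIsometry_extension (LinearMap.range j.toLinearMap)
    (Disp.subtypeₗᵢ.comp (u.comp j.equivRange.symm.toLinearIsometry)) fun a => (u _).2
  refine ⟨⟨v.toLinearMap.codRestrict Disp hvD, fun b => v.norm_map b⟩, fun a => Subtype.ext ?_⟩
  exact (hv (j.equivRange a)).trans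
    (congrArg (fun x => (u x : Ambient)) (j.equivRange.symm_apply_apply a))

theorem summable_abs_base (φ : Functionals) : Summable fun n => |φ.1 (.base n)| :=
  summable_of_sum_le (c := 1) (fun _ => abs_nonneg _) φ.2.1

theorem tsum_abs_base_le (φ : Functionals) : ∑' n, |φ.1 (.base n)| ≤ 1 :=
  (summable_abs_base φ).tsum_le_of_sum_le φ.2.1

theorem abs_tsum_base_le (φ : Functionals) : |∑' n, φ.1 (.base n)| ≤ 1 :=
  (norm_tsum_le_tsum_norm (f := fun n => φ.1 (.base n)) (summable_abs_base φ)).trans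
    (tsum_abs_base_le φ)

/-- The pointwise sum of the basic generators. -/
noncomputable def baseSum : Ambient :=
  ⟨fun φ => ∑' n, φ.1 (.base n), memℓp_infty ⟨1, by
    rintro _ ⟨φ, rfl⟩
    exact abs_tsum_base_le φ⟩⟩

theorem norm_sub_baseSum_le (n : ℕ) :
    ‖(2 : ℝ) • ∑ k ∈ Finset.range n, gen (.base k) - baseSum‖ ≤ 1 := by
  refine norm_le_of_abs_evalAt_le zero_le_one fun φ => ?_
  have h := summable_abs_base φ
  have h1 : evalAt φ baseSum = ∑' k, φ.1 (.base k) := rfl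
  rw [map_sub, map_smul, map_sum, h1, smul_eq_mul]
  simp only [evalAt_gen]
  have h2 := h.of_abs.sum_add_tsum_nat_add n
  have h3 := h.sum_add_tsum_nat_add n
  have h4 : ∑' k, |φ.1 (.base k)| ≤ 1 := tsum_abs_base_le φ
  have h5 := Finset.abs_sum_le_sum_abs (fun k => φ.1 (.base k)) (Finset.range n)
  have h6 : |∑' k, φ.1 (.base (k + n))| ≤ ∑' k, |φ.1 (.base (k + n))| :=
    norm_tsum_le_tsum_norm (f := fun k => φ.1 (.base (k + n))) ((summable_nat_add_iff n).2 h)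
  rw [← h2]
  rw [abs_le] at *
  constructor <;> linarith

/-- There is a sequence of contractive functionals, vanishing in the limit, which is biorthogonal to
the basic generators. -/
theorem exists_coordinates : ∃ φ : ℕ → Functionals,
    (∀ f ∈ Disp, Tendsto (fun m => evalAt (φ m) f) atTop (𝓝 0)) ∧
      ∀ n m, evalAt (φ m) (gen (.base n)) = if n = m then 1 else 0 := by
  classical
  let σ : Gen → ℕ → ℝ := fun j m => if j = .base m then 1 else 0
  have hb (n m : ℕ) : σ (.base n) m = if n = m then 1 else 0 := by simp [σ]
  have hσ : BaseAdm σ := by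
    refine ⟨fun n => ?_, fun m F => ?_⟩
    · refine tendsto_const_nhds.congr' <| (eventually_gt_atTop n).mono fun m hm => ?_
      rw [hb, if_neg hm.ne]
    · simp only [hb]
      rw [Finset.sum_congr rfl fun n _ => apply_ite abs (n = m) (1 : ℝ) 0]
      simp only [abs_one, abs_zero, Finset.sum_ite_eq']
      split_ifs <;> norm_num
  obtain ⟨h1, h2⟩ := adm_iff.1 (adm_extend hσ)
  refine ⟨fun m => ⟨_, h1 m⟩, fun f hf => tendsto_evalAt h2 hf, fun n m => ?_⟩
  rw [evalAt_gen, ← hb]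
  change extend σ (.base n) m = _
  rw [extend]

theorem separableSpace_topologicalClosure_span {E : Type*} [NormedAddCommGroup E] [NormedSpace ℝ E]
    {s : Set E} (hs : s.Countable) :
    TopologicalSpace.SeparableSpace (Submodule.span ℝ s).topologicalClosure :=
  (hs.isSeparable.span (R := ℝ)).closure.separableSpace

theorem not_univDispSeparable_disp : ¬ UnivDispSeparable Disp := by
  intro h
  let s : Set Ambient := Set.range fun n => gen (.base n)
  let A := (Submodule.span ℝ s).topologicalClosure
  let B := (Submodule.span ℝ (insert baseSum s)).topologicalClosure
  have hs : s.Countable := Set.countable_range _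
  have : TopologicalSpace.SeparableSpace A := separableSpace_topologicalClosure_span hs
  have : TopologicalSpace.SeparableSpace B :=
    separableSpace_topologicalClosure_span (hs.insert _)
  have : CompleteSpace A := (Submodule.isClosed_topologicalClosure _).completeSpace_coe
  have : CompleteSpace B := (Submodule.isClosed_topologicalClosure _).completeSpace_coe
  have hAD : A ≤ Disp := Submodule.topologicalClosure_mono
    (Submodule.span_mono (by rintro _ ⟨n, rfl⟩; exact ⟨_, rfl⟩))
  have hAB : A ≤ B :=
    Submodule.topologicalClosure_mono (Submodule.span_mono (Set.subset_insert _ _))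
  obtain ⟨v, hv⟩ := h A B ⟨Submodule.inclusion hAD, fun _ => rfl⟩
    ⟨Submodule.inclusion hAB, fun _ => rfl⟩
  have hbA (n : ℕ) : gen (.base n) ∈ A :=
    Submodule.le_topologicalClosure _ (Submodule.subset_span ⟨n, rfl⟩)
  let b : B := ⟨baseSum, Submodule.le_topologicalClosure _
    (Submodule.subset_span (Set.mem_insert _ _))⟩
  have hle (n : ℕ) : ‖(2 : ℝ) • ∑ k ∈ Finset.range n, gen (.base k) - (v b : Ambient)‖ ≤ 1 := by
    let a : A := ⟨_, A.smul_mem 2 (A.sum_mem fun k (_ : k ∈ Finset.range n) => hbA k)⟩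
    have h1 := congrArg (Subtype.val : Disp → Ambient) (hv a)
    have h2 : ‖v (Submodule.inclusion hAB a) - v b‖ ≤ 1 := by
      rw [← map_sub, v.norm_map]
      exact norm_sub_baseSum_le n
    have h3 : ‖(v (Submodule.inclusion hAB a) : Ambient) - v b‖ ≤ 1 := h2
    rwa [show (v (Submodule.inclusion hAB a) : Ambient) = a from h1] at h3
  obtain ⟨φ, hφ, hφb⟩ := exists_coordinates
  obtain ⟨m, hm⟩ := ((hφ _ (v b).2).eventually (gt_mem_nhds zero_lt_one)).exists
  have h3 := (abs_evalAt_le (φ m) _).trans (hle (m + 1))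
  rw [map_sub, map_smul, map_sum] at h3
  simp only [hφb, Finset.sum_ite_eq', Finset.mem_range, Nat.lt_succ_self, if_true] at h3
  rw [smul_eq_mul, abs_le] at h3
  linarith [h3.2]

theorem completeSpace_disp : CompleteSpace Disp :=
  (Submodule.isClosed_topologicalClosure _).completeSpace_coe

end FinDimDisposition

/-- There is a Banach space of universal disposition for finite-dimensional spaces which is
not of universal disposition for separable spaces. -/
theorem exists_univDispFinDim_not_univDispSeparable :
    ∃ U : BanachSpaceR, UnivDispFinDim U.carrier ∧ ¬ UnivDispSeparable U.carrier := by
  exact ⟨{ carrier := FinDimDisposition.Disp, complete := FinDimDisposition.completeSpace_disp },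
    FinDimDisposition.univDispFinDim_disp, FinDimDisposition.not_univDispSeparable_disp⟩
end

section
/- Assume that no real Banach space of density character 𝔠 is universal for all real Banach spaces of density character 𝔠; that is, for every real Banach space V of density character 𝔠 there exists a real Banach space X of density character 𝔠 admitting no isomorphic embedding into V. Then there exist an index set I of cardinality 𝔠 and a family (U_i)_{i ∈ I} of real Banach spaces, each of universal disposition for separable spaces and of density character 𝔠, such that for distinct i, j ∈ I the spaces U_i and U_j are not isomorphic (there is no bicontinuous linear bijection between them). -/
open Cardinal

/-- The density character of a topological space: the least cardinality of a dense subset. -/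
noncomputable def densityCharacter (X : Type*) [TopologicalSpace X] : Cardinal :=
  sInf {c : Cardinal | ∃ D : Set X, Dense D ∧ #D = c}

/-! ### Hahn–Banach for seminorms -/

/-- Hahn–Banach extension along a linear map: a functional dominated by the pullback of a seminorm
factors through a functional dominated by the seminorm. -/
theorem Seminorm.exists_dominated_extension {V W : Type*} [AddCommGroup V] [Module ℝ V]
    [AddCommGroup W] [Module ℝ W] (r : Seminorm ℝ W) (T : V →ₗ[ℝ] W) (f : V →ₗ[ℝ] ℝ)
    (hf : ∀ v, |f v| ≤ r (T v)) :
    ∃ g : W →ₗ[ℝ] ℝ, (∀ v, g (T v) = f v) ∧ ∀ w, |g w| ≤ r w := by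
  obtain ⟨s, hs⟩ := T.rangeRestrict.exists_rightInverse_of_surjective T.range_rangeRestrict
  have hTs : ∀ y : LinearMap.range T, T (s y) = y := fun y =>
    congrArg Subtype.val (LinearMap.congr_fun hs y)
  obtain ⟨g, hg, hgr⟩ := exists_extension_of_le_sublinear ⟨LinearMap.range T, f ∘ₗ s⟩ r
    (fun c hc x => by rw [map_smul_eq_mul, Real.norm_of_nonneg hc.le]) (map_add_le_add r)
    (fun y => by
      have := (le_abs_self _).trans (hf (s y))
      rwa [hTs] at this)
  refine ⟨g, fun v => ?_, fun w => abs_le.2 ⟨?_, hgr w⟩⟩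
  · have h1 : g (T v) = f (s ⟨T v, v, rfl⟩) := hg ⟨T v, v, rfl⟩
    have h2 := hf (s ⟨T v, v, rfl⟩ - v)
    rw [map_sub T, hTs, sub_self, map_zero, map_sub] at h2
    have h3 := abs_nonpos_iff.1 h2
    rw [h1]
    linarith
  · have := hgr (-w)
    rw [map_neg, map_neg_eq_map] at this
    linarith

/-- Every vector is normed by a functional dominated by a given seminorm. -/
theorem Seminorm.exists_norming_functional {W : Type*} [AddCommGroup W] [Module ℝ W]
    (r : Seminorm ℝ W) (w : W) : ∃ g : W →ₗ[ℝ] ℝ, g w = r w ∧ ∀ x, |g x| ≤ r x := by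
  obtain ⟨g, hg, hgr⟩ := r.exists_dominated_extension (LinearMap.toSpanSingleton ℝ W w)
    (LinearMap.toSpanSingleton ℝ ℝ (r w)) (fun c => by
      simp [map_smul_eq_mul, abs_mul, abs_of_nonneg (apply_nonneg r w)])
  refine ⟨g, ?_, hgr⟩
  simpa using hg 1

/-! ### The free extension -/

/-- Generators of the free extension of `X`: the points of `X` and, hereditarily, the vectors
`ext r w k` by which a sequence of generators `w` is to be extended so that the seminorm of the
combinations of `w` and of the new vectors is given by `r`. -/
inductive Gen (X : Type) : Type
  | base (x : X) : Gen X
  | ext (r : Seminorm ℝ (ℕ ⊕ ℕ →₀ ℝ)) (w : ℕ → Gen X) (k : ℕ) : Gen X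

namespace Gen

variable {X : Type}

/-- The generators of the extension prescribed by `r` and `w`: the old ones followed by the new
ones. -/
def node (r : Seminorm ℝ (ℕ ⊕ ℕ →₀ ℝ)) (w : ℕ → Gen X) : ℕ ⊕ ℕ → Gen X :=
  Sum.elim w (ext r w)

/-- The ordinal rank of a generator. -/
noncomputable def rank : Gen X → Ordinal.{0}
  | base _ => 0
  | ext _ w _ => ⨆ n, Order.succ (rank (w n))

theorem rank_lt (r : Seminorm ℝ (ℕ ⊕ ℕ →₀ ℝ)) (w : ℕ → Gen X) (k n : ℕ) :
    rank (w n) < rank (ext r w k) := by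
  rw [rank]
  exact (Order.lt_succ _).trans_le (Ordinal.le_iSup (fun n => Order.succ (rank (w n))) n)

open Classical in
/-- Values on the new vectors extending the values `f` on the old ones, dominated by `r` if
possible. -/
noncomputable def extendValues (r : Seminorm ℝ (ℕ ⊕ ℕ →₀ ℝ)) (f : ℕ → ℝ) : ℕ → ℝ :=
  if h : ∃ g : (ℕ ⊕ ℕ →₀ ℝ) →ₗ[ℝ] ℝ,
      (∀ n, g (Finsupp.single (Sum.inl n) 1) = f n) ∧ ∀ v, |g v| ≤ r v then
    fun k => h.choose (Finsupp.single (Sum.inr k) 1)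
  else 0

theorem extendValues_le (r : Seminorm ℝ (ℕ ⊕ ℕ →₀ ℝ)) (f : ℕ → ℝ) (k : ℕ) :
    |extendValues r f k| ≤ r (Finsupp.single (Sum.inr k) 1) := by
  unfold extendValues
  split_ifs with h
  · exact h.choose_spec.2 _
  · simp

theorem linearCombination_eq_of_single {ι : Type*} (g : (ι →₀ ℝ) →ₗ[ℝ] ℝ) (f : ι → ℝ)
    (h : ∀ i, g (Finsupp.single i 1) = f i) : Finsupp.linearCombination ℝ f = g := by
  ext i
  simp [h]

theorem dominated_extendValues (r : Seminorm ℝ (ℕ ⊕ ℕ →₀ ℝ)) (f : ℕ → ℝ)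
    (h : ∀ c, |Finsupp.linearCombination ℝ f c| ≤ r (Finsupp.mapDomain Sum.inl c))
    (v : ℕ ⊕ ℕ →₀ ℝ) :
    |Finsupp.linearCombination ℝ (Sum.elim f (extendValues r f)) v| ≤ r v := by
  have hex : ∃ g : (ℕ ⊕ ℕ →₀ ℝ) →ₗ[ℝ] ℝ,
      (∀ n, g (Finsupp.single (Sum.inl n) 1) = f n) ∧ ∀ v, |g v| ≤ r v := by
    obtain ⟨g, hg, hgr⟩ := r.exists_dominated_extension
      (Finsupp.lmapDomain ℝ ℝ (Sum.inl : ℕ → ℕ ⊕ ℕ)) (Finsupp.linearCombination ℝ f) h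
    exact ⟨g, fun n => by simpa using hg (Finsupp.single n 1), hgr⟩
  have hext : extendValues r f = fun k => hex.choose (Finsupp.single (Sum.inr k) 1) := dif_pos hex
  rw [linearCombination_eq_of_single hex.choose]
  · exact hex.choose_spec.2 v
  · rintro (n | k)
    · exact hex.choose_spec.1 n
    · rw [hext]
      rfl

/-- The functional on generators with values `f` on the base, prescribed values where `o` supplies
them, and chosen extensions elsewhere. -/
noncomputable def functional (f : X → ℝ)
    (o : Seminorm ℝ (ℕ ⊕ ℕ →₀ ℝ) → (ℕ → Gen X) → Option (ℕ → ℝ)) : Gen X → ℝ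
  | base x => f x
  | ext r w k => ((o r w).getD (extendValues r fun n => functional f o (w n))) k

variable [NormedAddCommGroup X] [NormedSpace ℝ X]

/-- `Dom v t` says that the inequality `‖v‖ ≤ t` is forced in the free extension of `X`. -/
inductive Dom : (Gen X →₀ ℝ) → ℝ → Prop
  | base (c : X →₀ ℝ) : Dom (Finsupp.mapDomain Gen.base c) ‖Finsupp.linearCombination ℝ id c‖
  | single (r : Seminorm ℝ (ℕ ⊕ ℕ →₀ ℝ)) (w : ℕ → Gen X) (k : ℕ) :
      Dom (Finsupp.single (ext r w k) 1) (r (Finsupp.single (Sum.inr k) 1))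
  | sum {v v' : Gen X →₀ ℝ} {t t' : ℝ} : Dom v t → Dom v' t' → Dom (v + v') (t + t')
  | mono {v : Gen X →₀ ℝ} {t t' : ℝ} : Dom v t → t ≤ t' → Dom v t'
  | smul (a : ℝ) {v : Gen X →₀ ℝ} {t : ℝ} : Dom v t → Dom (a • v) (|a| * t)
  | node (r : Seminorm ℝ (ℕ ⊕ ℕ →₀ ℝ)) (w : ℕ → Gen X)
      (h : ∀ (c : ℕ →₀ ℝ) (ε : ℝ), 0 < ε →
        Dom (Finsupp.mapDomain w c) (r (Finsupp.mapDomain Sum.inl c) + ε))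
      (v : ℕ ⊕ ℕ →₀ ℝ) : Dom (Finsupp.mapDomain (Gen.node r w) v) (r v)

theorem Dom.nonneg {v : Gen X →₀ ℝ} {t : ℝ} (h : Dom v t) : 0 ≤ t := by
  induction h with
  | base c => exact norm_nonneg _
  | single r w k => exact apply_nonneg r _
  | sum _ _ h h' => exact add_nonneg h h'
  | mono _ htt h => exact h.trans htt
  | smul a _ h => exact mul_nonneg (abs_nonneg a) h
  | node r w _ v => exact apply_nonneg r v

theorem Dom.zero : Dom (0 : Gen X →₀ ℝ) 0 := by
  simpa using Dom.base (0 : X →₀ ℝ)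

theorem exists_dom (v : Gen X →₀ ℝ) : ∃ t, Dom v t := by
  induction v using Finsupp.induction_linear with
  | zero => exact ⟨0, Dom.zero⟩
  | add v v' h h' =>
    obtain ⟨t, ht⟩ := h
    obtain ⟨t', ht'⟩ := h'
    exact ⟨t + t', ht.sum ht'⟩
  | single s a =>
    have h1 : ∃ t, Dom (Finsupp.single s (1 : ℝ)) t := by
      cases s with
      | base x => exact ⟨_, by simpa using Dom.base (Finsupp.single x (1 : ℝ))⟩
      | ext r w k => exact ⟨_, Dom.single r w k⟩
    obtain ⟨t, ht⟩ := h1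
    exact ⟨|a| * t, by simpa using ht.smul a⟩

theorem bddBelow_dom (v : Gen X →₀ ℝ) : BddBelow {t | Dom v t} := ⟨0, fun _ ht => ht.nonneg⟩

/-- The seminorm of the free extension. -/
noncomputable def freeSeminorm : Seminorm ℝ (Gen X →₀ ℝ) :=
  Seminorm.ofSMulLE (fun v => sInf {t | Dom v t})
    (le_antisymm (csInf_le (bddBelow_dom _) Dom.zero)
      (le_csInf (exists_dom _) fun _ ht => ht.nonneg))
    (fun v v' => by
      rw [← csInf_add (s := {t | Dom v t}) (t := {t | Dom v' t}) (exists_dom v) (bddBelow_dom v)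
        (exists_dom v') (bddBelow_dom v')]
      refine csInf_le_csInf (bddBelow_dom _) (Set.Nonempty.add (exists_dom v) (exists_dom v')) ?_
      rintro _ ⟨t, ht, t', ht', rfl⟩
      exact Dom.sum ht ht')
    (fun a v => by
      rw [← smul_eq_mul, ← Real.sInf_smul_of_nonneg (norm_nonneg a)]
      refine csInf_le_csInf (bddBelow_dom _) (Set.Nonempty.smul_set (exists_dom v)) ?_
      rintro _ ⟨t, ht, rfl⟩
      exact Dom.smul a ht)

theorem Dom.freeSeminorm_le {v : Gen X →₀ ℝ} {t : ℝ} (h : Dom v t) : freeSeminorm v ≤ t :=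
  csInf_le (bddBelow_dom v) h

theorem le_freeSeminorm {v : Gen X →₀ ℝ} {b : ℝ} (h : ∀ t, Dom v t → b ≤ t) :
    b ≤ freeSeminorm v :=
  le_csInf (exists_dom v) h

theorem dom_of_freeSeminorm_lt {v : Gen X →₀ ℝ} {b : ℝ} (h : freeSeminorm v < b) : Dom v b := by
  obtain ⟨t, ht, htb⟩ := exists_lt_of_csInf_lt (exists_dom v) h
  exact ht.mono htb.le

theorem abs_functional_le_of_dom (f : X → ℝ)
    (o : Seminorm ℝ (ℕ ⊕ ℕ →₀ ℝ) → (ℕ → Gen X) → Option (ℕ → ℝ))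
    (hf : ∀ c : X →₀ ℝ, |Finsupp.linearCombination ℝ f c| ≤ ‖Finsupp.linearCombination ℝ id c‖)
    (ho₁ : ∀ r w g, o r w = some g → ∀ k, |g k| ≤ r (Finsupp.single (Sum.inr k) 1))
    (ho₂ : ∀ r w g, o r w = some g →
      (∀ (c : ℕ →₀ ℝ) (ε : ℝ), 0 < ε →
        Dom (Finsupp.mapDomain w c) (r (Finsupp.mapDomain Sum.inl c) + ε)) →
      ∀ v, |Finsupp.linearCombination ℝ (Sum.elim (functional f o ∘ w) g) v| ≤ r v)
    {v : Gen X →₀ ℝ} {t : ℝ} (h : Dom v t) :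
    |Finsupp.linearCombination ℝ (functional f o) v| ≤ t := by
  induction h with
  | base c =>
    rw [Finsupp.linearCombination_mapDomain]
    exact hf c
  | single r w k =>
    rw [Finsupp.linearCombination_single, one_smul, functional]
    cases hrw : o r w with
    | none => exact extendValues_le r _ k
    | some g => exact ho₁ r w g hrw k
  | sum _ _ h h' =>
    rw [map_add]
    exact (abs_add_le _ _).trans (add_le_add h h')
  | mono _ htt h => exact h.trans htt
  | smul a _ h =>
    rw [map_smul, smul_eq_mul, abs_mul]
    gcongr
  | node r w h v ih =>
    have key : functional f o ∘ Gen.node r w = Sum.elim (functional f o ∘ w)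
        ((o r w).getD (extendValues r (functional f o ∘ w))) := by
      ext (n | k)
      · rfl
      · simp [Gen.node, functional, Function.comp_def]
    rw [Finsupp.linearCombination_mapDomain, key]
    cases hrw : o r w with
    | none =>
      refine dominated_extendValues r _ (fun c => le_of_forall_pos_le_add fun ε hε => ?_) v
      rw [← Finsupp.linearCombination_mapDomain]
      exact ih c ε hε
    | some g => exact ho₂ r w g hrw h v

theorem freeSeminorm_base (c : X →₀ ℝ) :
    freeSeminorm (Finsupp.mapDomain base c) = ‖Finsupp.linearCombination ℝ id c‖ := by
  refine le_antisymm (Dom.base c).freeSeminorm_le (le_freeSeminorm fun t ht => ?_)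
  obtain ⟨g, hg, hgr⟩ := (normSeminorm ℝ X).exists_norming_functional
    (Finsupp.linearCombination ℝ id c)
  have hlin : ∀ c : X →₀ ℝ, Finsupp.linearCombination ℝ g c
      = g (Finsupp.linearCombination ℝ id c) := fun c => by
    rw [Finsupp.apply_linearCombination]
    rfl
  have := abs_functional_le_of_dom g (fun _ _ => none)
    (fun c => by rw [hlin]; exact hgr _) (by simp) (by simp) ht
  rw [Finsupp.linearCombination_mapDomain] at this
  have h2 : functional g (fun _ _ => none) ∘ base = g := rfl
  rw [h2, hlin, hg] at this
  exact (le_abs_self _).trans this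

open Classical in
theorem freeSeminorm_node (r : Seminorm ℝ (ℕ ⊕ ℕ →₀ ℝ)) (w : ℕ → Gen X)
    (h : ∀ c : ℕ →₀ ℝ, freeSeminorm (Finsupp.mapDomain w c) = r (Finsupp.mapDomain Sum.inl c))
    (v : ℕ ⊕ ℕ →₀ ℝ) : freeSeminorm (Finsupp.mapDomain (node r w) v) = r v := by
  refine le_antisymm (Dom.node r w (fun c ε hε => dom_of_freeSeminorm_lt ?_) v).freeSeminorm_le
    (le_freeSeminorm fun t ht => ?_)
  · rw [h]
    linarith
  obtain ⟨ψ, hψ, hψr⟩ := r.exists_norming_functional v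
  obtain ⟨F, hF, hFr⟩ := freeSeminorm.exists_dominated_extension
    (Finsupp.lmapDomain ℝ ℝ w) (ψ ∘ₗ Finsupp.lmapDomain ℝ ℝ Sum.inl)
    (fun c => (hψr _).trans (h c).ge)
  set f : Gen X → ℝ := fun s => F (Finsupp.single s 1) with hfdef
  have hfF : ∀ x, Finsupp.linearCombination ℝ f x = F x := fun x =>
    LinearMap.congr_fun (linearCombination_eq_of_single F f fun _ => rfl) x
  set α := rank (ext r w 0) with hα
  have hrank : ∀ (r') (w' : ℕ → Gen X) (k : ℕ), rank (ext r' w' k) = rank (ext r' w' 0) :=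
    fun _ _ _ => by rw [rank, rank]
  let o : Seminorm ℝ (ℕ ⊕ ℕ →₀ ℝ) → (ℕ → Gen X) → Option (ℕ → ℝ) := fun r' w' =>
    if rank (ext r' w' 0) < α then some fun k => f (ext r' w' k)
    else if r' = r ∧ w' = w then some fun k => ψ (Finsupp.single (Sum.inr k) 1) else none
  have hlow : ∀ s : Gen X, rank s < α → functional (f ∘ base) o s = f s := by
    rintro (x | ⟨r', w', k⟩) hs
    · rfl
    · rw [hrank] at hs
      simp [functional, o, hs]
  have hw : functional (f ∘ base) o ∘ w = fun n => ψ (Finsupp.single (Sum.inl n) 1) := by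
    ext n
    rw [Function.comp_apply, hlow _ (rank_lt r w 0 n)]
    simpa using hF (Finsupp.single n 1)
  have hnode : Finsupp.linearCombination ℝ (Sum.elim (functional (f ∘ base) o ∘ w)
      fun k => ψ (Finsupp.single (Sum.inr k) 1)) = ψ := by
    rw [hw]
    exact linearCombination_eq_of_single _ _ (by rintro (n | k) <;> rfl)
  have key := abs_functional_le_of_dom (f ∘ base) o
    (fun c => by
      rw [← Finsupp.linearCombination_mapDomain, hfF, ← freeSeminorm_base]
      exact hFr _)
    (fun r' w' g hg k => by
      simp only [o] at hg
      split_ifs at hg with h1 h2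
      · obtain rfl := Option.some.inj hg
        exact (hFr _).trans (Dom.single r' w' k).freeSeminorm_le
      · obtain rfl := Option.some.inj hg
        rw [h2.1]
        exact hψr _)
    (fun r' w' g hg hdom u => by
      simp only [o] at hg
      split_ifs at hg with h1 h2
      · obtain rfl := Option.some.inj hg
        have : Sum.elim (functional (f ∘ base) o ∘ w') (fun k => f (ext r' w' k))
            = f ∘ node r' w' := by
          ext (n | k)
          · exact hlow _ ((rank_lt r' w' 0 n).trans h1)
          · rfl
        rw [this, ← Finsupp.linearCombination_mapDomain, hfF]
        exact (hFr _).trans (Dom.node r' w' hdom u).freeSeminorm_le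
      · obtain rfl := Option.some.inj hg
        obtain ⟨rfl, rfl⟩ := h2
        rw [hnode]
        exact hψr u)
    ht
  have hcomp : functional (f ∘ base) o ∘ node r w = Sum.elim (functional (f ∘ base) o ∘ w)
      fun k => ψ (Finsupp.single (Sum.inr k) 1) := by
    ext (n | k)
    · rfl
    · simp [node, functional, o, hα]
  rw [Finsupp.linearCombination_mapDomain, hcomp, hnode, hψ] at key
  exact (le_abs_self _).trans key

end Gen

/-! ### The universal extension of a Banach space -/

/-- The free vector space on the generators over `X`, with the free seminorm. -/
def FreeExtension (X : Type) : Type := Gen X →₀ ℝ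

namespace FreeExtension

variable (X : Type)

noncomputable instance : AddCommGroup (FreeExtension X) :=
  inferInstanceAs (AddCommGroup (Gen X →₀ ℝ))

noncomputable instance : Module ℝ (FreeExtension X) :=
  inferInstanceAs (Module ℝ (Gen X →₀ ℝ))

variable [NormedAddCommGroup X] [NormedSpace ℝ X]

noncomputable instance : Norm (FreeExtension X) := ⟨Gen.freeSeminorm (X := X)⟩

theorem core : SeminormedSpace.Core ℝ (FreeExtension X) where
  norm_nonneg := apply_nonneg (Gen.freeSeminorm (X := X))
  norm_smul := map_smul_eq_mul (Gen.freeSeminorm (X := X))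
  norm_triangle := map_add_le_add (Gen.freeSeminorm (X := X))

noncomputable instance : SeminormedAddCommGroup (FreeExtension X) :=
  SeminormedAddCommGroup.ofCore (core X)

noncomputable instance : NormedSpace ℝ (FreeExtension X) where
  norm_smul_le c x := ((core X).norm_smul c x).le

/-- Finitely supported functions as elements of the free extension. -/
noncomputable def of : (Gen X →₀ ℝ) →ₗ[ℝ] FreeExtension X := LinearMap.id

end FreeExtension

/-- A Banach space of universal disposition for separable spaces containing `X`. -/
abbrev UniversalExtension (X : Type) [NormedAddCommGroup X] [NormedSpace ℝ X] : Type :=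
  UniformSpace.Completion (FreeExtension X)

/-- Two linear maps inducing the same seminorm, the first with dense range, are intertwined by a
linear isometry. -/
theorem exists_linearIsometry_of_norm_eq {V E F : Type*} [AddCommGroup V] [Module ℝ V]
    [NormedAddCommGroup E] [NormedSpace ℝ E] [NormedAddCommGroup F] [NormedSpace ℝ F]
    [CompleteSpace F] (e : V →ₗ[ℝ] E) (f : V →ₗ[ℝ] F) (he : DenseRange e)
    (h : ∀ v, ‖f v‖ = ‖e v‖) : ∃ g : E →ₗᵢ[ℝ] F, ∀ v, g (e v) = f v := by
  have hC : ∃ C : ℝ, ∀ v, ‖f v‖ ≤ C * ‖e v‖ := ⟨1, fun v => by rw [h, one_mul]⟩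
  refine ⟨⟨(f.extendOfNorm e : E →ₗ[ℝ] F), fun x => ?_⟩, fun v => f.extendOfNorm_eq he hC v⟩
  refine he.induction_on (p := fun x => ‖f.extendOfNorm e x‖ = ‖x‖) x
    (isClosed_eq (by fun_prop) (by fun_prop)) fun v => ?_
  rw [f.extendOfNorm_eq he hC, h]

namespace UniversalExtension

variable {X : Type} [NormedAddCommGroup X] [NormedSpace ℝ X]

/-- The linear combinations of a family of generators as elements of the completion. -/
noncomputable def combination {ι : Type*} (w : ι → Gen X) :
    (ι →₀ ℝ) →ₗ[ℝ] UniversalExtension X :=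
  (UniformSpace.Completion.toComplL (𝕜 := ℝ) (E := FreeExtension X)).toLinearMap ∘ₗ
    FreeExtension.of X ∘ₗ Finsupp.lmapDomain ℝ ℝ w

theorem combination_apply {ι : Type*} (w : ι → Gen X) (c : ι →₀ ℝ) :
    combination w c = ((FreeExtension.of X (Finsupp.mapDomain w c) : FreeExtension X) :
      UniversalExtension X) :=
  rfl

theorem norm_combination {ι : Type*} (w : ι → Gen X) (c : ι →₀ ℝ) :
    ‖combination w c‖ = Gen.freeSeminorm (Finsupp.mapDomain w c) :=
  UniformSpace.Completion.norm_coe (E := FreeExtension X) _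

theorem combination_mapDomain {ι κ : Type*} (w : ι → Gen X) (g : κ → ι) (c : κ →₀ ℝ) :
    combination w (Finsupp.mapDomain g c) = combination (w ∘ g) c := by
  rw [combination_apply, combination_apply, ← Finsupp.mapDomain_comp]

theorem denseRange_combination_id : DenseRange (combination (id : Gen X → Gen X)) := by
  refine (UniformSpace.Completion.denseRange_coe (α := FreeExtension X)).mono ?_
  rintro _ ⟨c, rfl⟩
  refine ⟨(show Gen X →₀ ℝ from c), ?_⟩
  rw [combination_apply, Finsupp.mapDomain_id]
  rfl

/-- The base space embeds isometrically. -/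
theorem exists_linearIsometry : Nonempty (X →ₗᵢ[ℝ] UniversalExtension X) := by
  obtain ⟨g, -⟩ := exists_linearIsometry_of_norm_eq
    (Finsupp.linearCombination ℝ (id : X → X)) (combination (X := X) Gen.base)
    (Function.Surjective.denseRange fun x => ⟨Finsupp.single x 1, by simp⟩)
    fun c => by rw [norm_combination, Gen.freeSeminorm_base]
  exact ⟨g⟩

/-- Every separable subset lies in the closed span of countably many generators. -/
theorem exists_sequence_of_separable {A : Type*} [TopologicalSpace A]
    [TopologicalSpace.SeparableSpace A] (u : A → UniversalExtension X) (hu : Continuous u) :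
    ∃ w : ℕ → Gen X, ∀ a, u a ∈ closure (Set.range (combination w)) := by
  obtain ⟨D, hDc, hD⟩ := TopologicalSpace.exists_countable_dense A
  have happrox : ∀ (a : A) (n : ℕ), ∃ c : Gen X →₀ ℝ,
      dist (u a) (combination id c) < 1 / ((n : ℝ) + 1) := fun a n =>
    denseRange_combination_id.exists_dist_lt (u a) Nat.one_div_pos_of_nat
  choose c hc using happrox
  have hcount : (insert (Gen.base 0) (⋃ a ∈ D, ⋃ n, ((c a n).support : Set (Gen X)))).Countable :=
    (hDc.biUnion fun a _ => Set.countable_iUnion fun n => (c a n).support.countable_toSet).insert _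
  obtain ⟨w, hw⟩ := hcount.exists_eq_range (Set.insert_nonempty _ _)
  refine ⟨w, fun a => ?_⟩
  have hDsub : D ⊆ u ⁻¹' closure (Set.range (combination w)) := by
    intro a ha
    refine Metric.mem_closure_iff.2 fun ε hε => ?_
    obtain ⟨n, hn⟩ := exists_nat_one_div_lt hε
    have hsupp : ((c a n).support : Set (Gen X)) ⊆ Set.range w := by
      rw [← hw]
      intro s hs
      exact Set.mem_insert_of_mem _ (Set.mem_biUnion ha (Set.mem_iUnion.2 ⟨n, hs⟩))
    have hd : Finsupp.mapDomain w (Finsupp.mapDomain (Function.invFun w) (c a n)) = c a n := by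
      rw [← Finsupp.mapDomain_comp]
      conv_rhs => rw [← Finsupp.mapDomain_id (v := c a n)]
      exact Finsupp.mapDomain_congr fun s hs => Function.invFun_eq (hsupp hs)
    refine ⟨_, ⟨Finsupp.mapDomain (Function.invFun w) (c a n), rfl⟩, ?_⟩
    rw [combination_apply, hd, ← Finsupp.mapDomain_id (v := c a n), ← combination_apply]
    exact (hc a n).trans hn
  exact (isClosed_closure.preimage hu).closure_subset_iff.2 hDsub (hD a)

end UniversalExtension

/-- The seminorm of the amalgam of two spaces over a common subspace. -/
theorem exists_pushout_seminorm {A E F : Type*} [NormedAddCommGroup A] [NormedSpace ℝ A]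
    [NormedAddCommGroup E] [NormedSpace ℝ E] [NormedAddCommGroup F] [NormedSpace ℝ F]
    (u : A →ₗᵢ[ℝ] E) (j : A →ₗᵢ[ℝ] F) :
    ∃ q : Seminorm ℝ (E × F), (∀ y, q (y, 0) = ‖y‖) ∧ (∀ z, q (0, z) = ‖z‖) ∧
      (∀ y z, q (y, z) ≤ ‖y‖ + ‖z‖) ∧ ∀ a, q (u a, -j a) = 0 := by
  have hbdd : ∀ x : E × F, BddBelow (Set.range fun a => ‖x.1 + u a‖ + ‖x.2 - j a‖) := fun x =>
    ⟨0, by rintro _ ⟨a, rfl⟩; positivity⟩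
  have hle : ∀ (x : E × F) (a : A),
      ⨅ a, (‖x.1 + u a‖ + ‖x.2 - j a‖) ≤ ‖x.1 + u a‖ + ‖x.2 - j a‖ := fun x a =>
    ciInf_le (hbdd x) a
  have hnonneg : ∀ x : E × F, 0 ≤ ⨅ a, (‖x.1 + u a‖ + ‖x.2 - j a‖) := fun x =>
    le_ciInf fun a => by positivity
  refine ⟨Seminorm.ofSMulLE (fun x => ⨅ a, (‖x.1 + u a‖ + ‖x.2 - j a‖)) ?_ ?_ ?_, ?_, ?_, ?_, ?_⟩
  · exact le_antisymm (by simpa using hle 0 0) (hnonneg 0)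
  · intro x x'
    refine le_ciInf_add_ciInf fun a a' => (hle _ (a + a')).trans ?_
    have h1 : (x + x').1 + u (a + a') = (x.1 + u a) + (x'.1 + u a') := by
      rw [map_add, Prod.fst_add]; abel
    have h2 : (x + x').2 - j (a + a') = (x.2 - j a) + (x'.2 - j a') := by
      rw [map_add, Prod.snd_add]; abel
    rw [h1, h2]
    linarith [norm_add_le (x.1 + u a) (x'.1 + u a'), norm_add_le (x.2 - j a) (x'.2 - j a')]
  · intro c x
    rw [Real.mul_iInf_of_nonneg (norm_nonneg c)]
    refine le_ciInf fun a => (hle _ (c • a)).trans_eq ?_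
    rw [map_smul, map_smul, Prod.smul_fst, Prod.smul_snd, ← smul_add, ← smul_sub, norm_smul,
      norm_smul, mul_add]
  · intro y
    refine le_antisymm ((hle (y, 0) 0).trans_eq (by simp)) (le_ciInf fun a => ?_)
    have := norm_sub_le (y + u a) (u a)
    rw [add_sub_cancel_right, u.norm_map] at this
    simpa [zero_sub, norm_neg, j.norm_map] using this
  · intro z
    refine le_antisymm ((hle (0, z) 0).trans_eq (by simp)) (le_ciInf fun a => ?_)
    have := norm_add_le (z - j a) (j a)
    rw [sub_add_cancel, j.norm_map] at this
    simpa [zero_add, u.norm_map, add_comm] using this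
  · intro y z
    exact (hle (y, z) 0).trans_eq (by simp)
  · intro a
    exact le_antisymm ((hle (u a, -j a) (-a)).trans_eq (by simp)) (hnonneg _)

theorem univDispSeparable_universalExtension (X : Type) [NormedAddCommGroup X] [NormedSpace ℝ X] :
    UnivDispSeparable (UniversalExtension X) := by
  intro A B _ _ _ _ _ _ _ _ u j
  obtain ⟨w, hw⟩ := UniversalExtension.exists_sequence_of_separable u u.continuous
  obtain ⟨q, hq₁, hq₂, hq, hq₀⟩ := exists_pushout_seminorm u j
  set b : ℕ → B := TopologicalSpace.denseSeq B
  set P : (ℕ ⊕ ℕ →₀ ℝ) →ₗ[ℝ] UniversalExtension X × B :=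
    Finsupp.linearCombination ℝ (Sum.elim
      (fun n => (UniversalExtension.combination w (Finsupp.single n 1), (0 : B)))
      fun k => (0, b k)) with hP
  have hPl : ∀ c : ℕ →₀ ℝ, P (Finsupp.mapDomain Sum.inl c)
      = (UniversalExtension.combination w c, 0) := by
    intro c
    have : P ∘ₗ Finsupp.lmapDomain ℝ ℝ Sum.inl
        = LinearMap.inl ℝ _ B ∘ₗ UniversalExtension.combination w := by
      ext n <;> simp [hP]
    exact LinearMap.congr_fun this c
  have hPr : ∀ d : ℕ →₀ ℝ, P (Finsupp.mapDomain Sum.inr d)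
      = (0, Finsupp.linearCombination ℝ b d) := by
    intro d
    have : P ∘ₗ Finsupp.lmapDomain ℝ ℝ Sum.inr
        = LinearMap.inr ℝ (UniversalExtension X) B ∘ₗ Finsupp.linearCombination ℝ b := by
      ext n <;> simp [hP]
    exact LinearMap.congr_fun this d
  set r : Seminorm ℝ (ℕ ⊕ ℕ →₀ ℝ) := q.comp P with hr
  have hnode : ∀ v, ‖UniversalExtension.combination (Gen.node r w) v‖ = q (P v) := by
    intro v
    rw [UniversalExtension.norm_combination, Gen.freeSeminorm_node r w (fun c => ?_)]
    · rfl
    · rw [hr, Seminorm.comp_apply, hPl, hq₁, UniversalExtension.norm_combination]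
  have hnl : ∀ c : ℕ →₀ ℝ, UniversalExtension.combination (Gen.node r w)
      (Finsupp.mapDomain Sum.inl c) = UniversalExtension.combination w c :=
    UniversalExtension.combination_mapDomain _ _
  have hbdense : DenseRange (Finsupp.linearCombination ℝ b) :=
    (TopologicalSpace.denseRange_denseSeq B).mono
      (by rintro _ ⟨n, rfl⟩; exact ⟨Finsupp.single n 1, by simp [b]⟩)
  obtain ⟨u', hu'⟩ := exists_linearIsometry_of_norm_eq (Finsupp.linearCombination ℝ b)
    (UniversalExtension.combination (Gen.node r w) ∘ₗ Finsupp.lmapDomain ℝ ℝ Sum.inr) hbdense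
    (fun d => by
      rw [LinearMap.comp_apply, Finsupp.lmapDomain_apply, hnode, hPr, hq₂])
  refine ⟨u', fun a => ?_⟩
  rw [← dist_le_zero]
  refine le_of_forall_pos_le_add fun ε hε => ?_
  obtain ⟨_, ⟨c, rfl⟩, hc⟩ := Metric.mem_closure_iff.1 (hw a) (ε / 4) (by positivity)
  obtain ⟨d, hd⟩ := hbdense.exists_dist_lt (j a) (show 0 < ε / 4 by positivity)
  rw [dist_eq_norm] at hc hd
  have h1 : ‖UniversalExtension.combination w c - u' (Finsupp.linearCombination ℝ b d)‖
      ≤ ε / 4 + ε / 4 := by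
    have e1 : UniversalExtension.combination w c - u' (Finsupp.linearCombination ℝ b d)
        = UniversalExtension.combination (Gen.node r w)
          (Finsupp.mapDomain Sum.inl c - Finsupp.mapDomain Sum.inr d) := by
      rw [map_sub, hnl, hu']
      rfl
    have e2 : P (Finsupp.mapDomain Sum.inl c - Finsupp.mapDomain Sum.inr d)
        = (u a, -j a) - (u a - UniversalExtension.combination w c,
          -(j a - Finsupp.linearCombination ℝ b d)) := by
      rw [map_sub, hPl, hPr]
      refine Prod.ext (by simp) ?_
      simp only [Prod.snd_sub]
      abel
    rw [e1, hnode, e2]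
    refine (map_sub_le_add q _ _).trans ?_
    rw [hq₀, zero_add]
    refine (hq _ _).trans ?_
    rw [norm_neg]
    linarith
  have h2 : ‖u' (Finsupp.linearCombination ℝ b d) - u' (j a)‖ < ε / 4 := by
    rw [← map_sub, u'.norm_map, norm_sub_rev]
    exact hd
  rw [dist_comm, dist_eq_norm, zero_add]
  have e3 : u a - u' (j a) = (u a - UniversalExtension.combination w c)
      + (UniversalExtension.combination w c - u' (Finsupp.linearCombination ℝ b d))
      + (u' (Finsupp.linearCombination ℝ b d) - u' (j a)) := by abel
  rw [e3]
  linarith [norm_add₃_le (a := u a - UniversalExtension.combination w c)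
    (b := UniversalExtension.combination w c - u' (Finsupp.linearCombination ℝ b d))
    (c := u' (Finsupp.linearCombination ℝ b d) - u' (j a))]

/-! ### Cardinalities and density characters -/

theorem densityCharacter_le_of_dense {E : Type} [TopologicalSpace E] {D : Set E} (hD : Dense D) :
    densityCharacter E ≤ #D :=
  csInf_le' ⟨D, hD, rfl⟩

theorem exists_dense_mk_eq_densityCharacter (E : Type) [TopologicalSpace E] :
    ∃ D : Set E, Dense D ∧ #D = densityCharacter E :=
  csInf_mem (s := {c : Cardinal | ∃ D : Set E, Dense D ∧ #D = c}) ⟨_, Set.univ, dense_univ, rfl⟩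

theorem mk_le_continuum_of_densityCharacter_le {E : Type} [MetricSpace E]
    (h : densityCharacter E ≤ 𝔠) : #E ≤ 𝔠 := by
  obtain ⟨D, hD, hDc⟩ := exists_dense_mk_eq_densityCharacter E
  have hex : ∀ x : E, ∃ s : ℕ → D, Filter.Tendsto (fun n => (s n : E)) Filter.atTop (nhds x) := by
    intro x
    obtain ⟨s, hs, hlim⟩ := mem_closure_iff_seq_limit.1 (hD x)
    exact ⟨fun n => ⟨s n, hs n⟩, hlim⟩
  choose s hs using hex
  have hinj : Function.Injective s := fun x y hxy =>
    tendsto_nhds_unique (hs x) (by rw [hxy]; exact hs y)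
  calc #E ≤ #(ℕ → D) := mk_le_of_injective hinj
    _ = #D ^ ℵ₀ := by simp
    _ ≤ 𝔠 ^ ℵ₀ := power_le_power_right (hDc.trans_le h)
    _ = 𝔠 := continuum_power_aleph0

theorem continuum_le_densityCharacter_of_isometry {E F : Type} [MetricSpace E] [MetricSpace F]
    {e : E → F} (he : Isometry e) (h : 𝔠 ≤ densityCharacter E) : 𝔠 ≤ densityCharacter F := by
  classical
  obtain ⟨D, hD, hDc⟩ := exists_dense_mk_eq_densityCharacter F
  rw [← hDc]
  by_contra hlt
  have hE : Nonempty E := by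
    by_contra hE
    rw [not_nonempty_iff] at hE
    have := h.trans (densityCharacter_le_of_dense (D := (∅ : Set E)) fun x => hE.elim x)
    exact continuum_ne_zero (by simpa using this)
  let g : D × ℕ → E := fun p =>
    if hp : ∃ x, dist (e x) p.1 < 1 / ((p.2 : ℝ) + 1) then hp.choose else hE.some
  have hg : Dense (Set.range g) := by
    intro x
    refine Metric.mem_closure_iff.2 fun ε hε => ?_
    obtain ⟨n, hn⟩ := exists_nat_one_div_lt (half_pos hε)
    obtain ⟨d, hdD, hd⟩ := hD.exists_dist_lt (e x) (ε := 1 / ((n : ℝ) + 1))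
      Nat.one_div_pos_of_nat
    have hp : ∃ x, dist (e x) d < 1 / ((n : ℝ) + 1) := ⟨x, hd⟩
    refine ⟨_, ⟨(⟨d, hdD⟩, n), rfl⟩, ?_⟩
    have hgd : g (⟨d, hdD⟩, n) = hp.choose := dif_pos hp
    rw [hgd, ← he.dist_eq]
    calc dist (e x) (e hp.choose) ≤ dist (e x) d + dist (e hp.choose) d := dist_triangle_right _ _ _
      _ < ε := by linarith [hp.choose_spec]
  have h1 : 𝔠 ≤ #(D × ℕ) := h.trans ((densityCharacter_le_of_dense hg).trans mk_range_le)
  rw [mk_prod, lift_id, lift_id, mk_nat] at h1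
  exact absurd h1 (not_le.2 (mul_lt_of_lt aleph0_le_continuum (not_le.1 hlt) aleph0_lt_continuum))

theorem mk_le_densityCharacter_of_separated {E ι : Type} [MetricSpace E] (f : ι → E)
    (hf : ∀ i j, i ≠ j → 1 ≤ dist (f i) (f j)) : #ι ≤ densityCharacter E := by
  obtain ⟨D, hD, hDc⟩ := exists_dense_mk_eq_densityCharacter E
  rw [← hDc]
  choose g hgD hg using fun i => hD.exists_dist_lt (f i) (one_half_pos (α := ℝ))
  refine mk_le_of_injective (f := fun i => (⟨g i, hgD i⟩ : D)) fun i j hij => ?_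
  by_contra hne
  have h1 : g i = g j := congrArg Subtype.val hij
  have h2 := hg j
  rw [← h1] at h2
  linarith [hf i j hne, hg i, dist_triangle_right (f i) (f j) (g i)]

theorem Seminorm.exists_rat_approx {ι : Type*} (q : Seminorm ℝ (ι →₀ ℝ)) (x : ι →₀ ℝ) :
    ∀ ε > 0, ∃ c : ι →₀ ℚ, q (x - c.mapRange ((↑) : ℚ → ℝ) Rat.cast_zero) < ε := by
  induction x using Finsupp.induction_linear with
  | zero => exact fun ε hε => ⟨0, by simpa using hε⟩
  | add x y hx hy =>
    intro ε hε
    obtain ⟨c, hc⟩ := hx (ε / 2) (half_pos hε)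
    obtain ⟨d, hd⟩ := hy (ε / 2) (half_pos hε)
    refine ⟨c + d, ?_⟩
    rw [Finsupp.mapRange_add Rat.cast_add, add_sub_add_comm]
    linarith [map_add_le_add q (x - c.mapRange ((↑) : ℚ → ℝ) Rat.cast_zero)
      (y - d.mapRange ((↑) : ℚ → ℝ) Rat.cast_zero)]
  | single i a =>
    intro ε hε
    set M := q (Finsupp.single i 1)
    have hM : 0 ≤ M := apply_nonneg q _
    obtain ⟨b, hb⟩ := Rat.denseRange_cast (𝕜 := ℝ).exists_dist_lt a
      (show 0 < ε / (M + 1) by positivity)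
    refine ⟨Finsupp.single i b, ?_⟩
    have h1 : Finsupp.single i a - (Finsupp.single i b).mapRange ((↑) : ℚ → ℝ) Rat.cast_zero
        = (a - b) • Finsupp.single i (1 : ℝ) := by
      rw [Finsupp.mapRange_single, ← Finsupp.single_sub, Finsupp.smul_single, smul_eq_mul, mul_one]
    rw [h1, map_smul_eq_mul, ← dist_eq_norm]
    rw [lt_div_iff₀ (by positivity)] at hb
    nlinarith [dist_nonneg (x := a) (y := (b : ℝ))]

theorem Seminorm.ext_of_rat {ι : Type*} {p q : Seminorm ℝ (ι →₀ ℝ)}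
    (h : ∀ c : ι →₀ ℚ, p (c.mapRange ((↑) : ℚ → ℝ) Rat.cast_zero)
      = q (c.mapRange ((↑) : ℚ → ℝ) Rat.cast_zero)) : p = q := by
  ext x
  refine eq_of_forall_dist_le fun ε hε => ?_
  obtain ⟨c, hc⟩ := (p + q).exists_rat_approx x ε hε
  set y := c.mapRange ((↑) : ℚ → ℝ) Rat.cast_zero
  rw [add_apply] at hc
  have h1 := abs_le.1 (abs_sub_map_le_sub p x y)
  have h2 := abs_le.1 (abs_sub_map_le_sub q x y)
  rw [h c] at h1
  rw [Real.dist_eq, abs_le]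
  constructor <;> linarith

theorem mk_seminorm_le_continuum {ι : Type} [Countable ι] : #(Seminorm ℝ (ι →₀ ℝ)) ≤ 𝔠 := by
  have hinj : Function.Injective fun (p : Seminorm ℝ (ι →₀ ℝ)) (c : ι →₀ ℚ) =>
      p (c.mapRange ((↑) : ℚ → ℝ) Rat.cast_zero) := fun p q hpq =>
    Seminorm.ext_of_rat fun c => congrFun hpq c
  calc #(Seminorm ℝ (ι →₀ ℝ)) ≤ #((ι →₀ ℚ) → ℝ) := mk_le_of_injective hinj
    _ = 𝔠 ^ #(ι →₀ ℚ) := by rw [← power_def, mk_real]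
    _ ≤ 𝔠 ^ ℵ₀ := power_le_power_left continuum_ne_zero mk_le_aleph0
    _ = 𝔠 := continuum_power_aleph0

namespace Gen

/-- The labels of the generators over `X` seen as well-founded trees. -/
abbrev Label (X : Type) : Type := X ⊕ (Seminorm ℝ (ℕ ⊕ ℕ →₀ ℝ) × ℕ)

/-- The sets of children of the labels. -/
abbrev Children (X : Type) : Label X → Type := Sum.elim (fun _ => Empty) fun _ => ℕ

/-- The generators over `X` as well-founded trees. -/
def toTree {X : Type} : Gen X → WType (Children X)
  | base x => WType.mk (Sum.inl x) (fun i : Empty => i.elim)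
  | ext r w k => WType.mk (Sum.inr (r, k)) (fun n : ℕ => toTree (w n))

theorem toTree_injective {X : Type} : Function.Injective (toTree (X := X)) := by
  intro s
  induction s with
  | base x =>
    rintro (y | ⟨r, w, k⟩) h
    · exact congrArg base (Sum.inl.inj (WType.mk.inj h).1)
    · exact absurd (WType.mk.inj h).1 Sum.inl_ne_inr
  | ext r w k ih =>
    rintro (y | ⟨r', w', k'⟩) h
    · exact absurd (WType.mk.inj h).1 Sum.inr_ne_inl
    · obtain ⟨h1, h2⟩ := WType.mk.inj h
      obtain ⟨rfl, rfl⟩ := Prod.mk.inj (Sum.inr.inj h1)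
      have : w = w' := funext fun n => ih n (congrFun (eq_of_heq h2) n)
      rw [this]

theorem mk_le_continuum {X : Type} (hX : #X ≤ 𝔠) : #(Gen X) ≤ 𝔠 := by
  refine (mk_le_of_injective toTree_injective).trans (WType.cardinalMk_le_of_le ?_)
  have hlabel : #(Label X) ≤ 𝔠 := by
    rw [mk_sum, mk_prod, lift_id, lift_id, lift_id, lift_id, mk_nat]
    exact add_le_of_le aleph0_le_continuum hX
      (mul_le_of_le aleph0_le_continuum mk_seminorm_le_continuum aleph0_le_continuum)
  have hpow : ∀ a : Label X, 𝔠 ^ #(Children X a) ≤ (𝔠 : Cardinal.{0}) := by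
    rintro (x | x)
    · simpa [Children] using one_lt_aleph0.le.trans aleph0_le_continuum
    · simp [Children]
  calc sum (fun a : Label X => 𝔠 ^ #(Children X a)) ≤ sum fun _ : Label X => 𝔠 :=
        sum_le_sum _ _ hpow
    _ = #(Label X) * 𝔠 := by rw [sum_const']
    _ ≤ 𝔠 := mul_le_of_le aleph0_le_continuum hlabel le_rfl

end Gen

theorem densityCharacter_universalExtension {X : Type} [NormedAddCommGroup X] [NormedSpace ℝ X]
    (hX : densityCharacter X = 𝔠) : densityCharacter (UniversalExtension X) = 𝔠 := by
  refine le_antisymm ?_ ?_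
  · have : Nonempty (Gen X) := ⟨Gen.base 0⟩
    calc densityCharacter (UniversalExtension X)
        ≤ #(Set.range (UniversalExtension.combination (id : Gen X → Gen X))) :=
          densityCharacter_le_of_dense UniversalExtension.denseRange_combination_id
      _ ≤ #(Gen X →₀ ℝ) := mk_range_le
      _ = max #(Gen X) 𝔠 := by rw [mk_finsupp_of_infinite', mk_real]
      _ ≤ 𝔠 := max_le (Gen.mk_le_continuum (mk_le_continuum_of_densityCharacter_le hX.le)) le_rfl
  · obtain ⟨g⟩ := UniversalExtension.exists_linearIsometry (X := X)
    exact continuum_le_densityCharacter_of_isometry g.isometry hX.ge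

theorem mk_lp_one_le_continuum {ι : Type} {E : ι → Type} [∀ i, NormedAddCommGroup (E i)]
    (hι : #ι ≤ 𝔠) (hE : ∀ i, #(E i) ≤ 𝔠) : #(lp E 1) ≤ 𝔠 := by
  have hcount : ∀ f : lp E 1, {i | f i ≠ 0}.Countable := by
    intro f
    have hs := ((lp.memℓp f).summable (by simp)).countable_support
    refine hs.mono fun i hi => ?_
    simpa using hi
  let g : lp E 1 → {t : Set (Σ i, E i) // #t ≤ ℵ₀} := fun f =>
    ⟨(fun i => ⟨i, f i⟩) '' {i | f i ≠ 0}, le_aleph0_iff_set_countable.2 ((hcount f).image _)⟩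
  have hle : ∀ f f' : lp E 1, g f = g f' → ∀ i, f i ≠ 0 → f' i = f i := by
    intro f f' hff i hi
    have : (⟨i, f i⟩ : Σ i, E i) ∈ (g f').1 := by
      rw [← hff]
      exact ⟨i, hi, rfl⟩
    obtain ⟨i', -, hi'⟩ := this
    obtain ⟨rfl, h2⟩ := Sigma.mk.inj_iff.1 hi'
    exact eq_of_heq h2
  have hinj : Function.Injective g := by
    intro f f' hff
    ext i
    by_cases h1 : f i = 0
    · by_cases h2 : f' i = 0
      · rw [h1, h2]
      · exact hle f' f hff.symm i h2
    · exact (hle f f' hff i h1).symm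
  have hsig : #(Σ i, E i) ≤ 𝔠 := by
    rw [mk_sigma]
    calc sum (fun i => #(E i)) ≤ sum fun _ : ι => 𝔠 := sum_le_sum _ _ hE
      _ = #ι * 𝔠 := by rw [sum_const']
      _ ≤ 𝔠 := mul_le_of_le aleph0_le_continuum hι le_rfl
  calc #(lp E 1) ≤ #{t : Set (Σ i, E i) // #t ≤ ℵ₀} := mk_le_of_injective hinj
    _ ≤ max #(Σ i, E i) ℵ₀ ^ ℵ₀ := mk_bounded_set_le _ _
    _ ≤ 𝔠 ^ ℵ₀ := power_le_power_right (max_le hsig aleph0_le_continuum)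
    _ = 𝔠 := continuum_power_aleph0

/-- Any family of at most `𝔠` Banach spaces of cardinality at most `𝔠` embeds isometrically into a
single Banach space of density character `𝔠`. -/
theorem exists_common_superspace {J : Type} (hJ : #J ≤ 𝔠) (V : J → BanachSpaceR)
    (hV : ∀ j, #(V j).carrier ≤ 𝔠) :
    ∃ W : BanachSpaceR, densityCharacter W.carrier = 𝔠 ∧
      ∀ j, Nonempty ((V j).carrier →ₗᵢ[ℝ] W.carrier) := by
  classical
  let E : J ⊕ ℝ → BanachSpaceR := Sum.elim V fun _ => ⟨ℝ⟩
  have hcard : #(lp (fun s => (E s).carrier) 1) ≤ 𝔠 := by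
    refine mk_lp_one_le_continuum ?_ ?_
    · rw [mk_sum, lift_id, lift_id, mk_real]
      exact add_le_of_le aleph0_le_continuum hJ le_rfl
    · rintro (j | t)
      · exact hV j
      · exact mk_real.le
  refine ⟨⟨lp (fun s => (E s).carrier) 1⟩, le_antisymm ?_ ?_, fun j => ⟨?_⟩⟩
  · exact (densityCharacter_le_of_dense dense_univ).trans (mk_univ.trans_le hcard)
  · rw [← mk_real]
    let one : ∀ t : ℝ, (E (Sum.inr t)).carrier := fun _ => (1 : ℝ)
    refine mk_le_densityCharacter_of_separated
      (fun t : ℝ => (lp.single 1 (Sum.inr t) (one t) : lp (fun s => (E s).carrier) 1))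
      fun s t hst => ?_
    rw [dist_eq_norm]
    refine le_trans (le_of_eq ?_) (lp.norm_apply_le_norm one_ne_zero _ (Sum.inr s))
    rw [lp.coeFn_sub, Pi.sub_apply, lp.single_apply_self,
      lp.single_apply_ne _ _ _ (by simpa using hst), sub_zero]
    exact (norm_one (α := ℝ)).symm
  · exact
      { lp.lsingle (𝕜 := ℝ) (E := fun s => (E s).carrier) 1 (Sum.inl j) with
        norm_map' := fun x => lp.norm_single one_pos _ _ }

theorem exists_univDispSeparable_not_isomorphic
    (h : ∀ V : BanachSpaceR, densityCharacter V.carrier = Cardinal.continuum →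
      ∃ X : BanachSpaceR, densityCharacter X.carrier = Cardinal.continuum ∧
        ¬ ∃ (T : X.carrier →L[ℝ] V.carrier) (c : ℝ), 0 < c ∧
          ∀ x : X.carrier, c * ‖x‖ ≤ ‖T x‖)
    {J : Type} (hJ : #J ≤ 𝔠) (V : J → BanachSpaceR)
    (hV : ∀ j, densityCharacter (V j).carrier = 𝔠) :
    ∃ U : BanachSpaceR, (UnivDispSeparable U.carrier ∧ densityCharacter U.carrier = 𝔠) ∧
      ∀ j, IsEmpty (U.carrier ≃L[ℝ] (V j).carrier) := by
  obtain ⟨W, hW, hVW⟩ := exists_common_superspace hJ V fun j =>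
    mk_le_continuum_of_densityCharacter_le (hV j).le
  obtain ⟨X, hX, hXW⟩ := h W hW
  refine ⟨⟨UniversalExtension X.carrier⟩, ⟨univDispSeparable_universalExtension X.carrier,
    densityCharacter_universalExtension hX⟩, fun j =>
      ⟨fun (e : UniversalExtension X.carrier ≃L[ℝ] (V j).carrier) => hXW ?_⟩⟩
  obtain ⟨g⟩ := UniversalExtension.exists_linearIsometry (X := X.carrier)
  obtain ⟨i⟩ := hVW j
  let e' : (V j).carrier →L[ℝ] UniversalExtension X.carrier := e.symm
  let T : X.carrier →L[ℝ] W.carrier := i.toContinuousLinearMap ∘L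
    (e : UniversalExtension X.carrier →L[ℝ] (V j).carrier) ∘L g.toContinuousLinearMap
  refine ⟨T, (‖e'‖ + 1)⁻¹, by positivity, fun x => ?_⟩
  have h1 := e'.le_opNorm (e (g x))
  rw [inv_mul_le_iff₀ (by positivity)]
  have h2 : e' (e (g x)) = g x := e.symm_apply_apply _
  have h3 : ‖T x‖ = ‖e (g x)‖ := i.norm_map _
  rw [h2, g.norm_map] at h1
  rw [h3]
  linarith [norm_nonneg (e (g x))]

/-- If no Banach space of density character `𝔠` is universal for Banach spaces of density
character `𝔠`, then there is a family, indexed by a set of cardinality `𝔠`, of pairwise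
non-isomorphic Banach spaces of universal disposition for separable spaces, all of density
character `𝔠`. -/
theorem continuum_many_univDispSeparable
    (h : ∀ V : BanachSpaceR, densityCharacter V.carrier = Cardinal.continuum →
      ∃ X : BanachSpaceR, densityCharacter X.carrier = Cardinal.continuum ∧
        ¬ ∃ (T : X.carrier →L[ℝ] V.carrier) (c : ℝ), 0 < c ∧
          ∀ x : X.carrier, c * ‖x‖ ≤ ‖T x‖) :
    ∃ (I : Type) (U : I → BanachSpaceR), #I = Cardinal.continuum ∧
      (∀ i : I, UnivDispSeparable (U i).carrier ∧
        densityCharacter (U i).carrier = Cardinal.continuum) ∧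
      ∀ i j : I, i ≠ j → IsEmpty ((U i).carrier ≃L[ℝ] (U j).carrier) := by
  let P : Type 1 := {U : BanachSpaceR //
    UnivDispSeparable U.carrier ∧ densityCharacter U.carrier = Cardinal.continuum}
  have hstep : ∀ (s : ℝ) (V : ∀ t : ℝ, WellOrderingRel t s → P), ∃ U : P, ∀ t ht,
      IsEmpty (U.1.carrier ≃L[ℝ] (V t ht).1.carrier) := by
    intro s V
    obtain ⟨U, hU, hUV⟩ := exists_univDispSeparable_not_isomorphic h
      (J := {t : ℝ // WellOrderingRel t s}) ((mk_subtype_le _).trans mk_real.le)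
      (fun t => (V t.1 t.2).1) fun t => (V t.1 t.2).2.2
    exact ⟨⟨U, hU⟩, fun t ht => hUV ⟨t, ht⟩⟩
  choose next hnext using hstep
  have hwf : WellFounded (WellOrderingRel (α := ℝ)) := IsWellFounded.wf
  let U : ℝ → P := hwf.fix next
  have hU : ∀ s t, WellOrderingRel t s → IsEmpty ((U s).1.carrier ≃L[ℝ] (U t).1.carrier) := by
    intro s t hts
    have hfix : U s = next s fun t _ => U t := hwf.fix_eq next s
    rw [hfix]
    exact hnext s (fun t _ => U t) t hts
  refine ⟨ℝ, fun s => (U s).1, mk_real, fun s => (U s).2, fun s t hst => ?_⟩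
  rcases trichotomous_of (WellOrderingRel (α := ℝ)) s t with hlt | heq | hlt
  · exact ⟨fun e => (hU t s hlt).false e.symm⟩
  · exact absurd heq hst
  · exact hU s t hlt
end
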